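/- arXiv:1911.00574 — 2 statements merged into one kernel-verified Lean document; each statement's English description precedes it below -/
import Mathlib

section
/- Let Ω ⊂ ℝ² be open and bounded with D := diam Ω, let δ > 0, let λ₁, λ₂ > 0, and let ψ : ℝ² → ℝ be convex satisfying the transport inequality on Ω for nonnegative Radon measures μ, ν such that μ(R) ≥ |R|/λ₁ for every rectangle R ⊂ Ω and ν(R' ∩ ∂ψ(Ω)) ≤ λ₂|R'| for every rectangle R' ⊂ ℝ² (i.e. Assumption(h₁,h₂,λ₁,λ₂) with h₁ = h₂ = 0). Let L := sup{|z| : z ∈ ∂ψ(x), x ∈ Ω} and assume L < ∞. Then there is a constant C > 0 depending only on δ and D such that: (i) for every z ∈ ∂ψ(Ω^δ), the set {x ∈ ℝ² : z ∈ ∂ψ(x)} is a single point; and (ii) for all z, z' ∈ ∂ψ(Ω^δ) with z ≠ z' and all x, x' ∈ ℝ² with z ∈ ∂ψ(x) and z' ∈ ∂ψ(x'), one has |x − x'| ≤ C √(λ₁ λ₂) L / ( log( 1 + 1/(C √(λ₁ λ₂) |z − z'|) ) )^{1/8}. -/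
open MeasureTheory Set Metric Filter
open scoped RealInnerProductSpace ENNReal

noncomputable section

abbrev E2 := EuclideanSpace ℝ (Fin 2)

/-- The subdifferential of `ψ` at `x`:
`∂ψ(x) = {z : ψ(y) ≥ ψ(x) + z·(y−x) for all y}`. -/
def subdiff (ψ : E2 → ℝ) (x : E2) : Set E2 :=
  {z | ∀ y : E2, ψ x + ⟪z, y - x⟫ ≤ ψ y}

/-- `∂ψ(A) = ⋃_{x ∈ A} ∂ψ(x)`. -/
def subdiffSet (ψ : E2 → ℝ) (A : Set E2) : Set E2 :=
  ⋃ x ∈ A, subdiff ψ x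

/-- A rectangle of dimensions `a × b` in the plane: a rigid image of `[0,a] × [0,b]`. -/
def IsRectangle (R : Set E2) (a b : ℝ) : Prop :=
  ∃ f : E2 ≃ᵢ E2, R = f '' {p : E2 | p 0 ∈ Icc 0 a ∧ p 1 ∈ Icc 0 b}

/-- `ψ` satisfies the transport inequality `μ(A) ≤ ν(∂ψ(A))` for all Borel `A ⊆ Ω`. -/
def TransportIneq (Ω : Set E2) (ψ : E2 → ℝ) (μ ν : Measure E2) : Prop :=
  ∀ A : Set E2, A ⊆ Ω → MeasurableSet A → μ A ≤ ν (subdiffSet ψ A)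

/-- Assumption (h₁, h₂, λ₁, λ₂): `μ(R) ≥ |R|/λ₁` for every rectangle `R ⊆ Ω` with both
dimensions at least `h₁`, and `ν(R' ∩ ∂ψ(Ω)) ≤ λ₂ |R'|` for every rectangle `R'` with
both dimensions at least `h₂`. -/
def MeasAssump (Ω : Set E2) (ψ : E2 → ℝ) (μ ν : Measure E2)
    (h₁ h₂ l₁ l₂ : ℝ) : Prop :=
  (∀ (R : Set E2) (a b : ℝ), IsRectangle R a b → h₁ ≤ a → h₁ ≤ b → R ⊆ Ω →
      volume R ≤ ENNReal.ofReal l₁ * μ R) ∧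
  (∀ (R' : Set E2) (a b : ℝ), IsRectangle R' a b → h₂ ≤ a → h₂ ≤ b →
      ν (R' ∩ subdiffSet ψ Ω) ≤ ENNReal.ofReal l₂ * volume R')

/-- The δ-neighborhood `U_δ = ⋃_{z ∈ [x,y]} B_δ(z)` of the segment `[x,y]`. -/
def Useg (x y : E2) (δ : ℝ) : Set E2 := ⋃ z ∈ segment ℝ x y, closedBall z δ

/-- `ε = −min_{t ∈ [0,1]} ( ψ((1−t)x + ty) − (1−t)ψ(x) − tψ(y) )`. -/
def epsStar (ψ : E2 → ℝ) (x y : E2) : ℝ :=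
  - sInf ((fun t : ℝ => ψ ((1 - t) • x + t • y) - ((1 - t) * ψ x + t * ψ y)) '' Icc 0 1)

/-- `Ω^δ = {x ∈ Ω : dist(x, ∂Ω) > δ}`. -/
def innerSet (Ω : Set E2) (δ : ℝ) : Set E2 :=
  {p ∈ Ω | δ < infDist p (frontier Ω)}

lemma exists_subgrad {ψ : E2 → ℝ} (hψ : ConvexOn ℝ Set.univ ψ) (x : E2) :
    ∃ z, z ∈ subdiff ψ x := by
  have hc : Continuous ψ := hψ.locallyLipschitz.continuous
  have hconv : Convex ℝ {p : E2 × ℝ | p.1 ∈ Set.univ ∧ ψ p.1 < p.2} := hψ.convex_strict_epigraph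
  have hopen : IsOpen {p : E2 × ℝ | p.1 ∈ Set.univ ∧ ψ p.1 < p.2} := by
    have : {p : E2 × ℝ | p.1 ∈ Set.univ ∧ ψ p.1 < p.2} = {p : E2 × ℝ | ψ p.1 < p.2} := by
      ext; simp
    rw [this]
    exact isOpen_lt (hc.comp continuous_fst) continuous_snd
  obtain ⟨f, hf⟩ := geometric_hahn_banach_open_point (x := (x, ψ x)) hconv hopen (by simp)
  have hdec : ∀ (y : E2) (t : ℝ), f (y, t) = f (y, 0) + t * f (0, 1) := by
    intro y t
    have h1 : ((y, t) : E2 × ℝ) = (y, 0) + t • ((0 : E2), (1 : ℝ)) := by simp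
    rw [h1, map_add, map_smul, smul_eq_mul]
  set c := f (0, 1) with hcdef
  have hcneg : c < 0 := by
    have := hf (x, ψ x + 1) (by simp)
    rw [hdec x (ψ x + 1), hdec x (ψ x)] at this
    linarith
  let g : StrongDual ℝ E2 := f.comp (ContinuousLinearMap.inl ℝ E2 ℝ)
  have hg : ∀ y, g y = f (y, 0) := fun y => by simp [g]
  let w := (InnerProductSpace.toDual ℝ E2).symm g
  have hw : ∀ y, ⟪w, y⟫ = f (y, 0) := by
    intro y
    rw [← hg]
    exact InnerProductSpace.toDual_symm_apply
  refine ⟨(-c)⁻¹ • w, ?_⟩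
  intro y
  have hle : f (y, 0) + ψ y * c ≤ f (x, 0) + ψ x * c := by
    apply le_of_forall_pos_le_add
    intro e he
    have h1 := hf (y, ψ y + e / (-c)) (by
      have : 0 < e / (-c) := div_pos he (by linarith)
      simp only [Set.mem_univ, true_and, Set.mem_ofPred_eq]
      linarith)
    rw [hdec y, hdec x] at h1
    have h2 : e / (-c) * c = -e := by
      have : c ≠ 0 := hcneg.ne
      field_simp
    nlinarith
  rw [inner_smul_left, inner_sub_right, hw, hw]
  simp only [conj_trivial]
  have hc' : 0 < -c := by linarith
  have h3 : (-c)⁻¹ * (f (y, 0) - f (x, 0)) ≤ ψ y - ψ x := by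
    rw [inv_mul_le_iff₀ hc']
    nlinarith
  linarith

/-- Rectangle with centre `c`, axes `b`, half-sides `α`, `β`. -/
def crect (b : OrthonormalBasis (Fin 2) ℝ E2) (c : E2) (α β : ℝ) : Set E2 :=
  {p | |⟪b 0, p - c⟫| ≤ α ∧ |⟪b 1, p - c⟫| ≤ β}

lemma crect_isRectangle (b : OrthonormalBasis (Fin 2) ℝ E2) (c : E2) (α β : ℝ) :
    IsRectangle (crect b c α β) (2 * α) (2 * β) := by
  refine ⟨b.repr.symm.toIsometryEquiv.trans
    (IsometryEquiv.addRight (c - α • b 0 - β • b 1)), ?_⟩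
  have key : ∀ i, ∀ q : E2, (b.repr q) i = ⟪b i, q⟫ := fun i q => b.repr_apply_apply q i
  have h01 : ⟪b 0, b 1⟫ = 0 := b.orthonormal.2 (by decide)
  have h10 : ⟪b 1, b 0⟫ = 0 := b.orthonormal.2 (by decide)
  have h00 : ⟪b 0, b 0⟫ = 1 := by
    rw [real_inner_self_eq_norm_sq, b.orthonormal.1]; norm_num
  have h11 : ⟪b 1, b 1⟫ = 1 := by
    rw [real_inner_self_eq_norm_sq, b.orthonormal.1]; norm_num
  ext p
  constructor
  · rintro ⟨h0, h1⟩
    refine ⟨b.repr (p - (c - α • b 0 - β • b 1)), ?_, ?_⟩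
    · have e : p - (c - α • b 0 - β • b 1) = (p - c) + α • b 0 + β • b 1 := by abel
      simp only [Set.mem_ofPred_eq, key, e, inner_add_right, inner_smul_right, h00, h01, h10, h11,
        Set.mem_Icc]
      rw [abs_le] at h0 h1
      refine ⟨⟨?_, ?_⟩, ?_, ?_⟩ <;> linarith
    · simp
  · rintro ⟨q, ⟨h0, h1⟩, rfl⟩
    have e : (b.repr.symm.toIsometryEquiv.trans
      (IsometryEquiv.addRight (c - α • b 0 - β • b 1))) q - c
        = b.repr.symm q - α • b 0 - β • b 1 := by
      simp only [IsometryEquiv.trans_apply, IsometryEquiv.addRight_apply,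
        LinearIsometryEquiv.coe_toIsometryEquiv]
      abel
    have k : ∀ i, ⟪b i, b.repr.symm q⟫ = q i := by
      intro i; rw [← key]; simp
    simp only [crect, Set.mem_ofPred_eq]
    rw [e]
    simp only [inner_sub_right, inner_smul_right, h00, h01, h10, h11, k]
    simp only [Set.mem_Icc] at h0 h1
    constructor <;> rw [abs_le] <;> constructor <;> linarith

lemma volume_crect (b : OrthonormalBasis (Fin 2) ℝ E2) (c : E2) {α β : ℝ} (hα : 0 ≤ α) :
    volume (crect b c α β) = ENNReal.ofReal (4 * α * β) := by
  have e : crect b c α β = (fun p => WithLp.ofLp (b.repr (p - c))) ⁻¹'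
      (Set.pi Set.univ (fun i : Fin 2 => Icc (-(![α, β] i)) (![α, β] i))) := by
    ext p
    simp only [crect, Set.mem_ofPred_eq, Set.mem_preimage, Set.mem_pi, Set.mem_univ, true_imp_iff,
      Fin.forall_fin_two, b.repr_apply_apply, abs_le, Set.mem_Icc, Matrix.cons_val_zero,
      Matrix.cons_val_one]
  have mp : MeasurePreserving (fun p : E2 => WithLp.ofLp (b.repr (p - c))) volume volume :=
    (PiLp.volume_preserving_ofLp (Fin 2)).comp
      ((LinearIsometryEquiv.measurePreserving b.repr).comp (measurePreserving_sub_right volume c))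
  rw [e, mp.measure_preimage
    (MeasurableSet.univ_pi (fun i => measurableSet_Icc)).nullMeasurableSet, volume_pi_pi]
  simp only [Real.volume_Icc, Fin.prod_univ_two, Matrix.cons_val_zero, Matrix.cons_val_one]
  rw [← ENNReal.ofReal_mul (by linarith)]
  congr 1
  ring

lemma isClosed_crect (b : OrthonormalBasis (Fin 2) ℝ E2) (c : E2) (α β : ℝ) :
    IsClosed (crect b c α β) := by
  unfold crect
  exact IsClosed.and (isClosed_le (by fun_prop) continuous_const)
    (isClosed_le (by fun_prop) continuous_const)

lemma rect_transport {Ω : Set E2} {ψ : E2 → ℝ} {μ ν : Measure E2} {l₁ l₂ : ℝ}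
    (h1 : 0 < l₁) (h2 : 0 < l₂) (hT : TransportIneq Ω ψ μ ν) (hM : MeasAssump Ω ψ μ ν 0 0 l₁ l₂)
    (b : OrthonormalBasis (Fin 2) ℝ E2) (c c' : E2) {α β α' β' : ℝ}
    (hα : 0 ≤ α) (hβ : 0 ≤ β) (hα' : 0 ≤ α') (hβ' : 0 ≤ β') (hsub : crect b c α β ⊆ Ω)
    (him : ∀ x ∈ crect b c α β, ∀ q ∈ subdiff ψ x, q ∈ crect b c' α' β') :
    α * β ≤ l₁ * l₂ * (α' * β') := by
  have a1 := hM.1 _ _ _ (crect_isRectangle b c α β) (by linarith) (by linarith) hsub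
  have a2 := hM.2 _ _ _ (crect_isRectangle b c' α' β') (by linarith) (by linarith)
  have a3 := hT _ hsub (isClosed_crect b c α β).measurableSet
  have a4 : ν (subdiffSet ψ (crect b c α β)) ≤ ν (crect b c' α' β' ∩ subdiffSet ψ Ω) := by
    apply measure_mono
    intro q hq
    simp only [subdiffSet, Set.mem_iUnion] at hq ⊢
    obtain ⟨x, hx, hq⟩ := hq
    exact ⟨him x hx q hq, by simp only [Set.mem_iUnion]; exact ⟨x, hsub hx, hq⟩⟩
  have a5 : ENNReal.ofReal (4 * α * β) ≤ ENNReal.ofReal (l₁ * (l₂ * (4 * α' * β'))) := by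
    rw [ENNReal.ofReal_mul h1.le, ENNReal.ofReal_mul h2.le, ← volume_crect b c hα,
      ← volume_crect b c' hα']
    refine a1.trans ?_
    gcongr
    exact a3.trans (a4.trans a2)
  rw [ENNReal.ofReal_le_ofReal_iff (by positivity)] at a5
  nlinarith

lemma closedBall_subset_of_inner {Ω : Set E2} {δ : ℝ} (hδ : 0 < δ) (hΩ : IsOpen Ω) {p : E2}
    (hp : p ∈ innerSet Ω δ) : closedBall p δ ⊆ Ω := by
  have hpre : IsPreconnected (closedBall p δ) := (convex_closedBall p δ).isPreconnected
  refine hpre.subset_left_of_subset_union hΩ (isClosed_closure (s := Ω)).isOpen_compl ?_ ?_ ?_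
  · exact Set.disjoint_left.2 fun x hx hx' => hx' (subset_closure hx)
  · intro x hx
    by_contra hcon
    simp only [Set.mem_union, Set.mem_compl_iff, not_or, not_not] at hcon
    have hf : x ∈ frontier Ω := by
      rw [hΩ.frontier_eq]; exact ⟨hcon.2, hcon.1⟩
    have := infDist_le_dist_of_mem (x := p) hf
    rw [mem_closedBall, dist_comm] at hx
    linarith [hp.2]
  · exact ⟨p, mem_closedBall_self hδ.le, hp.1⟩

lemma subdiff_le {ψ : E2 → ℝ} {x z : E2} (hz : z ∈ subdiff ψ x) (v : E2) :
    ψ x + ⟪z, v⟫ ≤ ψ (x + v) := by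
  have := hz (x + v)
  simpa using this

lemma conv2 {ψ : E2 → ℝ} (hψ : ConvexOn ℝ Set.univ ψ) (x y : E2) (a b : ℝ) (ha : 0 ≤ a)
    (hb : 0 ≤ b) (hab : a + b = 1) : ψ (a • x + b • y) ≤ a * ψ x + b * ψ y :=
  hψ.2 (Set.mem_univ x) (Set.mem_univ y) ha hb hab

lemma convex_pt {ψ : E2 → ℝ} (hψ : ConvexOn ℝ Set.univ ψ) (c v : E2) {s A : ℝ} (hA : 0 < A)
    (hs : |s| ≤ A) :
    ψ (c + s • v) ≤ (1 + s / A) / 2 * ψ (c + A • v) + (1 - s / A) / 2 * ψ (c - A • v) := by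
  rw [abs_le] at hs
  have h1 : s / A ≤ 1 := by rw [div_le_one hA]; linarith
  have h2 : -1 ≤ s / A := by rw [le_div_iff₀ hA]; linarith
  have := conv2 hψ (c + A • v) (c - A • v)
    ((1 + s / A) / 2) ((1 - s / A) / 2) (by linarith) (by linarith) (by ring)
  have e : ((1 + s / A) / 2) • (c + A • v) + ((1 - s / A) / 2) • (c - A • v) = c + s • v := by
    have : s = (s / A) * A := by field_simp
    conv_rhs => rw [this]
    module
  rwa [e] at this

lemma key_lemma {Ω : Set E2} {ψ : E2 → ℝ} {μ ν : Measure E2} {l₁ l₂ : ℝ}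
    (h1 : 0 < l₁) (h2 : 0 < l₂) (hψ : ConvexOn ℝ Set.univ ψ)
    (hT : TransportIneq Ω ψ μ ν) (hM : MeasAssump Ω ψ μ ν 0 0 l₁ l₂)
    (b : OrthonormalBasis (Fin 2) ℝ E2) (c : E2) {A B : ℝ} (hA : 0 < A) (hB : 0 < B)
    (hsub : crect b c (A / 4) (B / 4) ⊆ Ω) :
    A * B ≤ 8 * Real.sqrt (l₁ * l₂) * ((ψ (c + A • b 0) + ψ (c - A • b 0) - 2 * ψ c) +
      (ψ (c + B • b 1) + ψ (c - B • b 1) - 2 * ψ c)) := by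
  obtain ⟨p, hp⟩ := exists_subgrad hψ c
  set M := (ψ (c + A • b 0) + ψ (c - A • b 0) - 2 * ψ c) +
      (ψ (c + B • b 1) + ψ (c - B • b 1) - 2 * ψ c) with hMdef
  -- one-dimensional bound
  have one : ∀ (v : E2) (T s : ℝ), 0 < T → |s| ≤ T →
      ψ (c + s • v) - ψ c - s * ⟪p, v⟫ ≤ ψ (c + T • v) + ψ (c - T • v) - 2 * ψ c := by
    intro v T s hT hs
    have k1 := convex_pt hψ c v hT hs
    have k2 := subdiff_le hp (T • v)
    have k3 := subdiff_le hp (-(T • v))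
    rw [inner_neg_right, ← sub_eq_add_neg c] at k3
    rw [inner_smul_right] at k2 k3
    rw [abs_le] at hs
    have g1 : s / T ≤ 1 := by rw [div_le_one hT]; linarith
    have g2 : -1 ≤ s / T := by rw [le_div_iff₀ hT]; linarith
    have hsT : s = (s / T) * T := by field_simp
    set r := s / T
    rw [hsT]
    rw [hsT] at k1
    have m1 : 0 ≤ (1 - (1 + r) / 2) * (ψ (c + T • v) - ψ c - T * ⟪p, v⟫) :=
      mul_nonneg (by linarith) (by linarith)
    have m2 : 0 ≤ (1 - (1 - r) / 2) * (ψ (c - T • v) - ψ c + T * ⟪p, v⟫) :=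
      mul_nonneg (by linarith) (by linarith)
    linarith
  have two : ∀ s t : ℝ, |s| ≤ A / 2 → |t| ≤ B / 2 →
      ψ (c + s • b 0 + t • b 1) - ψ c - s * ⟪p, b 0⟫ - t * ⟪p, b 1⟫ ≤ M / 2 := by
    intro s t hs ht
    have k1 := one (b 0) A (2 * s) hA (by rw [abs_mul, abs_two]; linarith)
    have k2 := one (b 1) B (2 * t) hB (by rw [abs_mul, abs_two]; linarith)
    have k3 := conv2 hψ (c + (2 * s) • b 0) (c + (2 * t) • b 1)
      (1 / 2) (1 / 2) (by norm_num) (by norm_num) (by norm_num)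
    have e : (1 / 2 : ℝ) • (c + (2 * s) • b 0) + (1 / 2 : ℝ) • (c + (2 * t) • b 1)
        = c + s • b 0 + t • b 1 := by module
    rw [e] at k3
    linarith
  have low : ∀ s t : ℝ, 0 ≤ ψ (c + s • b 0 + t • b 1) - ψ c - s * ⟪p, b 0⟫ - t * ⟪p, b 1⟫ := by
    intro s t
    have := subdiff_le hp (s • b 0 + t • b 1)
    rw [inner_add_right, inner_smul_right, inner_smul_right, ← add_assoc c] at this
    linarith
  have M0 : 0 ≤ M := by
    have := two 0 0 (by rw [abs_zero]; linarith) (by rw [abs_zero]; linarith)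
    have := low 0 0
    linarith
  have him : ∀ x ∈ crect b c (A / 4) (B / 4), ∀ q ∈ subdiff ψ x,
      q ∈ crect b p (M / 2 / (A / 4)) (M / 2 / (B / 4)) := by
    rintro x ⟨hx0, hx1⟩ q hq
    set s := ⟪b 0, x - c⟫
    set t := ⟪b 1, x - c⟫
    have hx : x = c + s • b 0 + t • b 1 := by
      have := b.sum_repr' (x - c)
      rw [Fin.sum_univ_two] at this
      rw [add_assoc, this]; abel
    have lw := low s t
    rw [← hx] at lw
    rw [abs_le] at hx0 hx1
    have st : ∀ s' t' : ℝ, |s'| ≤ A / 4 → |t'| ≤ B / 4 →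
        s' * ⟪b 0, q - p⟫ + t' * ⟪b 1, q - p⟫ ≤ M / 2 := by
      intro s' t' hs' ht'
      have k1 := subdiff_le hq (s' • b 0 + t' • b 1)
      rw [inner_add_right, inner_smul_right, inner_smul_right] at k1
      rw [abs_le] at hs' ht'
      have k2 := two (s + s') (t + t') (by rw [abs_le]; constructor <;> linarith)
        (by rw [abs_le]; constructor <;> linarith)
      have e : c + (s + s') • b 0 + (t + t') • b 1 = x + (s' • b 0 + t' • b 1) := by
        conv_rhs => rw [hx]
        module
      rw [e] at k2
      rw [inner_sub_right, inner_sub_right, real_inner_comm q (b 0), real_inner_comm p (b 0),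
        real_inner_comm q (b 1), real_inner_comm p (b 1)]
      linarith
    have hA4 : 0 < A / 4 := by linarith
    have hB4 : 0 < B / 4 := by linarith
    constructor
    · rw [le_div_iff₀ hA4]
      have a1 := st (A / 4) 0 (by rw [abs_of_pos hA4]) (by simp [hB4.le])
      have a2 := st (-(A / 4)) 0 (by rw [abs_neg, abs_of_pos hA4]) (by simp [hB4.le])
      rcases abs_cases ⟪b 0, q - p⟫ with ⟨h, _⟩ | ⟨h, _⟩ <;> rw [h] <;> linarith
    · rw [le_div_iff₀ hB4]
      have a1 := st 0 (B / 4) (by simp [hA4.le]) (by rw [abs_of_pos hB4])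
      have a2 := st 0 (-(B / 4)) (by simp [hA4.le]) (by rw [abs_neg, abs_of_pos hB4])
      rcases abs_cases ⟪b 1, q - p⟫ with ⟨h, _⟩ | ⟨h, _⟩ <;> rw [h] <;> linarith
  have fin := rect_transport h1 h2 hT hM b c p (by positivity) (by positivity) (by positivity)
    (by positivity) hsub him
  have hL : 0 < l₁ * l₂ := mul_pos h1 h2
  have hsq := Real.sq_sqrt hL.le
  have hs0 := Real.sqrt_nonneg (l₁ * l₂)
  set S := Real.sqrt (l₁ * l₂)
  rw [← hsq] at fin
  have e : S ^ 2 * (M / 2 / (A / 4) * (M / 2 / (B / 4))) = 4 * (S * M) ^ 2 / (A * B) := by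
    field_simp; ring
  rw [e, le_div_iff₀ (by positivity)] at fin
  have : (A * B) ^ 2 ≤ (8 * S * M) ^ 2 := by nlinarith
  exact (pow_le_pow_iff_left₀ (by positivity) (by positivity) (by norm_num)).1 this

lemma double_tel (g : ℕ → ℝ) (N : ℕ) :
    ∑ i ∈ Finset.range N, ∑ l ∈ Finset.range N, (g (i + l + 2) + g (i + l) - 2 * g (i + l + 1))
      = g (N + N) + g 0 - 2 * g N := by
  have h1 : ∀ i, ∑ l ∈ Finset.range N, (g (i + l + 2) + g (i + l) - 2 * g (i + l + 1))
      = (g (i + 1 + N) - g (i + N)) - (g (i + 1) - g i) := by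
    intro i
    have := Finset.sum_range_sub (fun l => g (i + l + 1) - g (i + l)) N
    simp only [add_zero] at this
    rw [show i + 1 + N = i + N + 1 by ring, ← this]
    refine Finset.sum_congr rfl fun l _ => ?_
    rw [show i + (l + 1) + 1 = i + l + 2 by ring, show i + (l + 1) = i + l + 1 by ring]
    ring
  simp only [h1]
  rw [Finset.sum_sub_distrib]
  have h2 := Finset.sum_range_sub (fun i => g (i + N)) N
  have h3 := Finset.sum_range_sub (fun i => g i) N
  simp only [zero_add] at h2
  rw [h2, h3]
  ring

lemma core {Ω : Set E2} {ψ : E2 → ℝ} {μ ν : Measure E2} {l₁ l₂ L δ d ε τ : ℝ} {K : ℕ}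
    (h1 : 0 < l₁) (h2 : 0 < l₂) (hψ : ConvexOn ℝ Set.univ ψ)
    (hT : TransportIneq Ω ψ μ ν) (hM : MeasAssump Ω ψ μ ν 0 0 l₁ l₂)
    (hL : ∀ x ∈ Ω, ∀ z ∈ subdiff ψ x, ‖z‖ ≤ L) (hL0 : 0 < L)
    (b : OrthonormalBasis (Fin 2) ℝ E2) (x z : E2) (hball : closedBall x δ ⊆ Ω)
    (hz : z ∈ subdiff ψ x) (hd : 0 < d) (hdδ : d ≤ δ / 2) (hdq : d ≤ Real.sqrt (l₁ * l₂) * L)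
    (hε : ∀ s, 0 ≤ s → s ≤ d → ψ (x + s • b 0) - ψ x - s * ⟪z, b 0⟫ ≤ ε)
    (hτ : 0 < τ) (hετ : ε ≤ L * τ) (hK : 3 ^ K * τ ≤ δ / 2) :
    K * d ^ 2 ≤ 20544 * (Real.sqrt (l₁ * l₂) * L) ^ 2 := by
  set S := Real.sqrt (l₁ * l₂) with hS
  have hS0 : 0 < S := Real.sqrt_pos.2 (mul_pos h1 h2)
  set q := S * L with hq
  have hq0 : 0 < q := mul_pos hS0 hL0
  have hδ : 0 < δ := by linarith
  -- choice of N
  obtain ⟨N, hN1, hN2⟩ : ∃ N : ℕ, 320 * q ≤ N * d ∧ N * d ≤ 321 * q := by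
    refine ⟨⌈320 * q / d⌉₊, ?_, ?_⟩
    · have := Nat.le_ceil (320 * q / d)
      rwa [div_le_iff₀ hd] at this
    · have := (Nat.ceil_lt_add_one (a := 320 * q / d) (by positivity)).le
      have h3 : (320 * q / d + 1) * d = 320 * q + d := by field_simp
      nlinarith
  have hNpos : 0 < (N : ℝ) := by
    by_contra hcon
    have : (N : ℝ) * d ≤ 0 := mul_nonpos_of_nonpos_of_nonneg (not_lt.1 hcon) hd.le
    linarith
  set A := d / (2 * N) with hA
  have hA0 : 0 < A := by positivity
  have hNA : N * A = d / 2 := by rw [hA]; field_simp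
  have nb : ∀ i, ‖b i‖ = 1 := fun i => b.orthonormal.1 i
  have memΩ : ∀ s t : ℝ, |s| ≤ d → |t| ≤ δ / 2 → x + s • b 0 + t • b 1 ∈ Ω := by
    intro s t hs ht
    apply hball
    rw [mem_closedBall, dist_eq_norm, show x + s • b 0 + t • b 1 - x = s • b 0 + t • b 1 by abel]
    refine (norm_add_le _ _).trans ?_
    rw [norm_smul, norm_smul, nb, nb, Real.norm_eq_abs, Real.norm_eq_abs]
    linarith
  have hzL : ‖z‖ ≤ L := hL x (hball (mem_closedBall_self hδ.le)) z hz
  have ib : ∀ (w : E2) i, ‖w‖ ≤ L → |⟪w, b i⟫| ≤ L := by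
    intro w i hw
    have := abs_real_inner_le_norm w (b i)
    rw [nb, mul_one] at this
    exact this.trans hw
  -- upper bound
  have up : ∀ s t : ℝ, 0 ≤ s → s ≤ d → 0 ≤ t → t ≤ δ / 2 →
      ψ (x + s • b 0 + t • b 1) - ψ x - s * ⟪z, b 0⟫ - t * ⟪z, b 1⟫ ≤ ε + 2 * L * t := by
    intro s t hs hsd ht htδ
    obtain ⟨p, hp⟩ := exists_subgrad hψ (x + s • b 0 + t • b 1)
    have hpL := hL _ (memΩ s t (by rw [abs_of_nonneg hs]; exact hsd)
      (by rw [abs_of_nonneg ht]; exact htδ)) p hp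
    have k := subdiff_le hp (-(t • b 1))
    rw [add_neg_cancel_right, inner_neg_right, inner_smul_right] at k
    have k2 := hε s hs hsd
    have k3 := (abs_le.1 (ib p 1 hpL)).2
    have k4 := (abs_le.1 (ib z 1 hzL)).1
    nlinarith
  have low : ∀ s t : ℝ, 0 ≤ ψ (x + s • b 0 + t • b 1) - ψ x - s * ⟪z, b 0⟫ - t * ⟪z, b 1⟫ := by
    intro s t
    have := subdiff_le hz (s • b 0 + t • b 1)
    rw [inner_add_right, inner_smul_right, inner_smul_right, ← add_assoc x] at this
    linarith
  have hex : ∀ s t : ℝ, ∃ p, p ∈ subdiff ψ (x + s • b 0 + t • b 1) := fun s t =>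
    exists_subgrad hψ _
  choose P hP using hex
  let G : ℕ → ℕ → ℝ := fun k j => ⟪P (j * A) (3 ^ k * τ), b 1⟫
  -- bounds on heights
  have h3k : ∀ k ≤ K, (3 : ℝ) ^ k * τ ≤ δ / 2 := by
    intro k hk
    refine le_trans ?_ hK
    gcongr
    norm_num
  have jA : ∀ j : ℕ, j ≤ N + N → (j : ℝ) * A ≤ d := by
    intro j hj
    have : (j : ℝ) ≤ N + N := by exact_mod_cast hj
    nlinarith
  have Gbd : ∀ k ≤ K, ∀ j ≤ N + N, |G k j| ≤ L := by
    intro k hk j hj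
    apply ib
    apply hL _ (memΩ _ _ _ _) _ (hP _ _)
    · rw [abs_of_nonneg (by positivity)]; exact jA j hj
    · rw [abs_of_nonneg (by positivity)]; exact h3k k hk
  have step : ∀ k ∈ Finset.range K, (N : ℝ) * N * A ≤ 8 * S * (10 * L +
      ∑ i ∈ Finset.range N, ∑ l ∈ Finset.range N, (G (k + 1) (i + l + 1) - G k (i + l + 1))) := by
    intro k hk
    have hkK : k + 1 ≤ K := Finset.mem_range.1 hk
    set B : ℝ := 3 ^ k * τ with hB
    have hB0 : 0 < B := by positivity
    have h3B : 3 ^ (k + 1) * τ = 3 * B := by rw [hB]; ring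
    have hBδ : 3 * B ≤ δ / 2 := by rw [← h3B]; exact h3k _ hkK
    let g : ℕ → ℝ := fun j => ψ (x + ((j : ℝ) * A) • b 0 + (2 * B) • b 1)
    have each : ∀ i ∈ Finset.range N, ∀ l ∈ Finset.range N, A * B ≤ 8 * S *
        ((g (i + l + 2) + g (i + l) - 2 * g (i + l + 1)) +
          B * (G (k + 1) (i + l + 1) - G k (i + l + 1))) := by
      intro i hi l hl
      have hi' := Finset.mem_range.1 hi
      have hl' := Finset.mem_range.1 hl
      set c := x + (((i + l + 1 : ℕ) : ℝ) * A) • b 0 + (2 * B) • b 1 with hc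
      have hj1 : ((i + l + 1 : ℕ) : ℝ) * A + A ≤ d := by
        have := jA (i + l + 2) (by omega)
        push_cast at this ⊢
        linarith
      have hj0 : 0 ≤ ((i + l + 1 : ℕ) : ℝ) * A := by positivity
      have hsub : crect b c (A / 4) (B / 4) ⊆ Ω := by
        rintro y ⟨hy0, hy1⟩
        have hy : y = x + (((i + l + 1 : ℕ) : ℝ) * A + ⟪b 0, y - c⟫) • b 0
            + (2 * B + ⟪b 1, y - c⟫) • b 1 := by
          have := b.sum_repr' (y - c)
          rw [Fin.sum_univ_two] at this
          have h' : y = c + (⟪b 0, y - c⟫ • b 0 + ⟪b 1, y - c⟫ • b 1) := by rw [this]; abel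
          generalize ⟪b 0, y - c⟫ = s at *
          generalize ⟪b 1, y - c⟫ = t at *
          rw [h', hc]
          module
        have hjA : A ≤ ((i + l + 1 : ℕ) : ℝ) * A := by
          push_cast
          have : 0 ≤ ((i : ℝ) + l) * A := by positivity
          linarith
        rw [abs_le] at hy0 hy1
        rw [hy]
        apply memΩ <;> rw [abs_le] <;> constructor <;> linarith
      have kl := key_lemma h1 h2 hψ hT hM b c hA0 hB0 hsub
      have e1 : ψ (c + A • b 0) = g (i + l + 2) := by
        simp only [g, hc]
        congr 1
        push_cast
        module
      have e2 : ψ (c - A • b 0) = g (i + l) := by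
        simp only [g, hc]
        congr 1
        push_cast
        module
      have e3 : ψ c = g (i + l + 1) := rfl
      have e4 : ψ (c + B • b 1) + ψ (c - B • b 1) - 2 * ψ c
          ≤ B * (G (k + 1) (i + l + 1) - G k (i + l + 1)) := by
        have f1 := subdiff_le (hP (((i + l + 1 : ℕ) : ℝ) * A) (3 ^ (k + 1) * τ)) (-(B • b 1))
        have f2 := subdiff_le (hP (((i + l + 1 : ℕ) : ℝ) * A) (3 ^ k * τ)) (B • b 1)
        have g1 : x + (((i + l + 1 : ℕ) : ℝ) * A) • b 0 + (3 ^ (k + 1) * τ) • b 1 + -(B • b 1)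
            = c := by rw [h3B, hc]; module
        have g2 : x + (((i + l + 1 : ℕ) : ℝ) * A) • b 0 + (3 ^ k * τ) • b 1 + B • b 1
            = c := by rw [← hB, hc]; module
        have g3 : x + (((i + l + 1 : ℕ) : ℝ) * A) • b 0 + (3 ^ (k + 1) * τ) • b 1 = c + B • b 1 := by
          rw [h3B, hc]; module
        have g4 : x + (((i + l + 1 : ℕ) : ℝ) * A) • b 0 + (3 ^ k * τ) • b 1 = c - B • b 1 := by
          rw [← hB, hc]; module
        rw [g1, g3, inner_neg_right, inner_smul_right] at f1
        rw [g2, g4, inner_smul_right] at f2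
        simp only [G]
        linarith
      rw [e1, e2] at kl
      refine kl.trans ?_
      have : 0 ≤ 8 * S := by positivity
      apply mul_le_mul_of_nonneg_left _ this
      rw [← e3]
      linarith
    have summed := Finset.sum_le_sum fun i hi => Finset.sum_le_sum fun l hl => each i hi l hl
    simp only [← Finset.mul_sum, Finset.sum_add_distrib] at summed
    rw [double_tel g N] at summed
    simp only [Finset.sum_const, Finset.card_range, nsmul_eq_mul] at summed
    set Q := ∑ i ∈ Finset.range N, ∑ l ∈ Finset.range N,
      (G (k + 1) (i + l + 1) - G k (i + l + 1)) with hQ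
    have gb : g (N + N) + g 0 - 2 * g N ≤ 10 * L * B := by
      have u1 := up (((N + N : ℕ) : ℝ) * A) (2 * B) (by positivity) (jA _ le_rfl) (by positivity)
        (by linarith)
      have u2 := up (((0 : ℕ) : ℝ) * A) (2 * B) (by positivity) (jA _ (by omega)) (by positivity)
        (by linarith)
      have u3 := low ((N : ℝ) * A) (2 * B)
      have hτB : L * τ ≤ L * B := by
        apply mul_le_mul_of_nonneg_left _ hL0.le
        rw [hB]
        have : (1 : ℝ) ≤ 3 ^ k := one_le_pow₀ (by norm_num)
        nlinarith
      simp only [g]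
      push_cast at u1 u2 ⊢
      linarith
    have fin : (N : ℝ) * N * A * B ≤ 8 * S * (10 * L + Q) * B := by
      have : 0 ≤ 8 * S := by positivity
      have := mul_le_mul_of_nonneg_left gb this
      linarith
    exact le_of_mul_le_mul_right fin hB0
  have tot := Finset.sum_le_sum step
  rw [Finset.sum_const, ← Finset.mul_sum, Finset.sum_add_distrib, Finset.sum_comm] at tot
  have tel : ∑ i ∈ Finset.range N, ∑ k ∈ Finset.range K, ∑ l ∈ Finset.range N,
      (G (k + 1) (i + l + 1) - G k (i + l + 1)) ≤ (N : ℝ) * (N * (2 * L)) := by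
    have : ∀ i ∈ Finset.range N, ∑ k ∈ Finset.range K, ∑ l ∈ Finset.range N,
      (G (k + 1) (i + l + 1) - G k (i + l + 1)) ≤ N * (2 * L) := by
      intro i hi
      rw [Finset.sum_comm]
      have : ∀ l ∈ Finset.range N, ∑ k ∈ Finset.range K,
          (G (k + 1) (i + l + 1) - G k (i + l + 1)) ≤ 2 * L := by
        intro l hl
        have hi' := Finset.mem_range.1 hi
        have hl' := Finset.mem_range.1 hl
        rw [Finset.sum_range_sub (fun k => G k (i + l + 1))]
        have a1 := abs_le.1 (Gbd K le_rfl (i + l + 1) (by omega))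
        have a2 := abs_le.1 (Gbd 0 (by omega) (i + l + 1) (by omega))
        linarith
      have := Finset.sum_le_sum this
      simpa using this
    have := Finset.sum_le_sum this
    simpa using this
  simp only [Finset.sum_const, Finset.card_range, nsmul_eq_mul] at tot
  have tot2 : K * (N * N * A) ≤ 8 * S * (K * (10 * L) + N * (N * (2 * L))) := by
    refine tot.trans ?_
    gcongr
  have tot3 : K * (N * d / 2) ≤ 80 * q * K + 16 * q * N * N := by
    have e : (N : ℝ) * N * A = N * d / 2 := by rw [mul_assoc, hNA]; ring
    rw [e] at tot2
    rw [hq]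
    linarith
  have hK0 : (0 : ℝ) ≤ K := by positivity
  have tot4 : K * (N * d / 4) ≤ 16 * q * N * N := by nlinarith
  have tot5 : K * d ≤ 64 * q * N := by
    have : (K * d) * N ≤ (64 * q * N) * N := by linarith
    exact le_of_mul_le_mul_right this hNpos
  calc K * d ^ 2 = (K * d) * d := by ring
    _ ≤ (64 * q * N) * d := by gcongr
    _ = 64 * q * (N * d) := by ring
    _ ≤ 64 * q * (321 * q) := by gcongr
    _ = 20544 * q ^ 2 := by ring

lemma q_lower {Ω : Set E2} {ψ : E2 → ℝ} {μ ν : Measure E2} {l₁ l₂ L δ : ℝ}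
    (h1 : 0 < l₁) (h2 : 0 < l₂) (hδ : 0 < δ)
    (hT : TransportIneq Ω ψ μ ν) (hM : MeasAssump Ω ψ μ ν 0 0 l₁ l₂)
    (hL : ∀ x ∈ Ω, ∀ z ∈ subdiff ψ x, ‖z‖ ≤ L)
    (x z : E2) (hball : closedBall x δ ⊆ Ω) (hz : z ∈ subdiff ψ x) :
    0 < L ∧ δ / 2 ≤ Real.sqrt (l₁ * l₂) * L := by
  have hL0 : 0 ≤ L := (norm_nonneg z).trans (hL x (hball (mem_closedBall_self hδ.le)) z hz)
  let b := EuclideanSpace.basisFun (Fin 2) ℝ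
  have nb : ∀ i, ‖b i‖ = 1 := fun i => b.orthonormal.1 i
  have hsub : crect b x (δ / 2) (δ / 2) ⊆ Ω := by
    rintro y ⟨hy0, hy1⟩
    apply hball
    rw [mem_closedBall, dist_eq_norm]
    have := b.sum_repr' (y - x)
    rw [Fin.sum_univ_two] at this
    rw [← this]
    refine (norm_add_le _ _).trans ?_
    rw [norm_smul, norm_smul, nb, nb, Real.norm_eq_abs, Real.norm_eq_abs]
    linarith
  have him : ∀ y ∈ crect b x (δ / 2) (δ / 2), ∀ p ∈ subdiff ψ y, p ∈ crect b 0 L L := by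
    intro y hy p hp
    have hpL := hL y (hsub hy) p hp
    have : ∀ i, |⟪b i, p - 0⟫| ≤ L := by
      intro i
      have := abs_real_inner_le_norm (b i) p
      rw [nb, one_mul] at this
      rw [sub_zero]
      exact this.trans hpL
    exact ⟨this 0, this 1⟩
  have fin := rect_transport h1 h2 hT hM b x 0 (by positivity) (by positivity) hL0 hL0 hsub him
  have hsq := Real.sq_sqrt (mul_pos h1 h2).le
  have hs0 := Real.sqrt_nonneg (l₁ * l₂)
  set S := Real.sqrt (l₁ * l₂)
  have h : (δ / 2) ^ 2 ≤ (S * L) ^ 2 := by rw [mul_pow, hsq]; nlinarith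
  have h' : δ / 2 ≤ S * L :=
    (pow_le_pow_iff_left₀ (by positivity) (by positivity) (by norm_num)).1 h
  refine ⟨?_, h'⟩
  rcases hL0.eq_or_lt with h0 | h0
  · rw [← h0, mul_zero] at h'; linarith
  · exact h0

lemma main_bound {Ω : Set E2} {ψ : E2 → ℝ} {μ ν : Measure E2} {l₁ l₂ L δ D' ε τ : ℝ} {K : ℕ}
    (h1 : 0 < l₁) (h2 : 0 < l₂) (hδ : 0 < δ) (hψ : ConvexOn ℝ Set.univ ψ)
    (hT : TransportIneq Ω ψ μ ν) (hM : MeasAssump Ω ψ μ ν 0 0 l₁ l₂)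
    (hL : ∀ x ∈ Ω, ∀ z ∈ subdiff ψ x, ‖z‖ ≤ L)
    (x y z : E2) (hball : closedBall x δ ⊆ Ω)
    (hz : z ∈ subdiff ψ x) (hxy : y ≠ x) (hD : δ ≤ D') (hr : dist x y ≤ D')
    (hε0 : 0 ≤ ε) (hε : ψ y - ψ x - ⟪z, y - x⟫ ≤ ε)
    (hτ : 0 < τ) (hετ : ε ≤ L * τ) (hK : 3 ^ K * τ ≤ δ / 2) :
    K * (δ / (2 * D') * dist x y) ^ 2 ≤ 20544 * (Real.sqrt (l₁ * l₂) * L) ^ 2 := by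
  obtain ⟨hL0, hq⟩ := q_lower h1 h2 hδ hT hM hL x z hball hz
  have hr0 : 0 < dist x y := dist_pos.2 hxy.symm
  have hrn : dist x y = ‖y - x‖ := by rw [dist_comm, dist_eq_norm]
  set r := dist x y with hrdef
  have hD0 : 0 < D' := by linarith
  set e : E2 := r⁻¹ • (y - x) with he
  have hne : ‖e‖ = 1 := by
    rw [he, norm_smul, ← hrn, Real.norm_eq_abs, abs_of_pos (by positivity)]
    field_simp
  obtain ⟨b, hb⟩ : ∃ b : OrthonormalBasis (Fin 2) ℝ E2, b 0 = e := by
    have ho : Orthonormal ℝ (({0} : Set (Fin 2)).restrict (fun _ : Fin 2 => e)) := by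
      refine ⟨fun i => hne, ?_⟩
      intro i j hij
      exact absurd (Subsingleton.elim i j) hij
    obtain ⟨b, hb⟩ := ho.exists_orthonormalBasis_extension_of_card_eq (by simp)
    exact ⟨b, hb 0 rfl⟩
  have hd1 : δ / (2 * D') * r ≤ δ / 2 := by
    rw [div_mul_eq_mul_div, div_le_div_iff₀ (by positivity) (by norm_num)]
    nlinarith
  refine core h1 h2 hψ hT hM hL hL0 b x z hball hz (by positivity) hd1 (hd1.trans hq) ?_ hτ hετ hK
  intro s hs0 hsd
  have hu0 : 0 ≤ s / r := by positivity
  have hu1 : s / r ≤ 1 := by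
    rw [div_le_one hr0]
    refine hsd.trans ?_
    have : δ / (2 * D') ≤ 1 := by rw [div_le_one (by positivity)]; linarith
    nlinarith
  have k := conv2 hψ x y (1 - s / r) (s / r) (by linarith) hu0 (by ring)
  have e1 : (1 - s / r) • x + (s / r) • y = x + s • b 0 := by
    rw [hb, he, smul_smul, div_eq_mul_inv]
    module
  have e2 : s * ⟪z, b 0⟫ = s / r * ⟪z, y - x⟫ := by
    rw [hb, he, inner_smul_right]; ring
  rw [e1] at k
  rw [e2]
  have : s / r * (ψ y - ψ x - ⟪z, y - x⟫) ≤ s / r * ε := mul_le_mul_of_nonneg_left hε hu0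
  have : s / r * ε ≤ 1 * ε := mul_le_mul_of_nonneg_right hu1 hε0
  linarith

lemma unique_pt {Ω : Set E2} {ψ : E2 → ℝ} {μ ν : Measure E2} {l₁ l₂ L δ : ℝ}
    (h1 : 0 < l₁) (h2 : 0 < l₂) (hδ : 0 < δ) (hψ : ConvexOn ℝ Set.univ ψ)
    (hT : TransportIneq Ω ψ μ ν) (hM : MeasAssump Ω ψ μ ν 0 0 l₁ l₂)
    (hL : ∀ x ∈ Ω, ∀ z ∈ subdiff ψ x, ‖z‖ ≤ L)
    (x y z : E2) (hball : closedBall x δ ⊆ Ω)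
    (hz : z ∈ subdiff ψ x) (hzy : z ∈ subdiff ψ y) : y = x := by
  by_contra hxy
  obtain ⟨hL0, hq⟩ := q_lower h1 h2 hδ hT hM hL x z hball hz
  have hr0 : 0 < dist x y := dist_pos.2 (Ne.symm hxy)
  set D' := dist x y + δ with hD'
  set d := δ / (2 * D') * dist x y with hd
  have hd0 : 0 < d := by positivity
  set q := Real.sqrt (l₁ * l₂) * L with hqd
  obtain ⟨K, hK⟩ := exists_nat_gt (20544 * q ^ 2 / d ^ 2)
  have hε : ψ y - ψ x - ⟪z, y - x⟫ ≤ 0 := by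
    have := hzy x
    rw [inner_sub_right] at this ⊢
    linarith
  have hp : (0 : ℝ) < 3 ^ K := by positivity
  have := main_bound (ε := 0) (τ := δ / 2 / 3 ^ K) (K := K) (D' := D') h1 h2 hδ hψ hT hM hL x y z
    hball hz hxy (by linarith) (by linarith) le_rfl hε (by positivity) (by positivity)
    (by rw [mul_div_cancel₀ _ hp.ne'])
  rw [div_lt_iff₀ (by positivity)] at hK
  linarith

/-- in the absolutely continuous case (h₁ = h₂ = 0), the inverse of the
subdifferential is single-valued on ∂ψ(Ω^δ) with an explicit modulus of continuity. -/
theorem stmt8 (δ D : ℝ) (hδ : 0 < δ) :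
    ∃ C : ℝ, 0 < C ∧
    ∀ (Ω : Set E2), IsOpen Ω → Bornology.IsBounded Ω → diam Ω = D →
    ∀ ψ : E2 → ℝ, ConvexOn ℝ Set.univ ψ →
    ∀ μ ν : Measure E2, IsLocallyFiniteMeasure μ → IsLocallyFiniteMeasure ν →
    ∀ l₁ l₂ : ℝ, 0 < l₁ → 0 < l₂ →
    TransportIneq Ω ψ μ ν → MeasAssump Ω ψ μ ν 0 0 l₁ l₂ →
    ∀ L : ℝ, (∀ x ∈ Ω, ∀ z ∈ subdiff ψ x, ‖z‖ ≤ L) →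
    (∀ z ∈ subdiffSet ψ (innerSet Ω δ), ∃ x₀ : E2, {x : E2 | z ∈ subdiff ψ x} = {x₀}) ∧
    (∀ z z' : E2, z ∈ subdiffSet ψ (innerSet Ω δ) → z' ∈ subdiffSet ψ (innerSet Ω δ) →
      z ≠ z' → ∀ x x' : E2, z ∈ subdiff ψ x → z' ∈ subdiff ψ x' →
      dist x x' ≤ C * Real.sqrt (l₁ * l₂) * L /
        (Real.log (1 + 1 / (C * Real.sqrt (l₁ * l₂) * dist z z'))) ^ ((1 : ℝ) / 8)) := by
  set D' := |D| + δ with hD'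
  have hD0 : 0 < D' := by positivity
  have hDδ : δ ≤ D' := by have := abs_nonneg D; linarith
  set C := 4 * D' / δ ^ 2 + 41092 * (2 * D' / δ) with hC
  have hC0 : 0 < C := by positivity
  refine ⟨C, hC0, ?_⟩
  intro Ω hΩ hbd hdiam ψ hψ μ ν _ _ l₁ l₂ h1 h2 hT hM L hL
  have single : ∀ z ∈ subdiffSet ψ (innerSet Ω δ), ∃ x₀ ∈ innerSet Ω δ, z ∈ subdiff ψ x₀ ∧
      ∀ y, z ∈ subdiff ψ y → y = x₀ := by
    intro z hz
    simp only [subdiffSet, Set.mem_iUnion] at hz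
    obtain ⟨x, hx, hzx⟩ := hz
    exact ⟨x, hx, hzx, fun y hy => unique_pt h1 h2 hδ hψ hT hM hL x y z
      (closedBall_subset_of_inner hδ hΩ hx) hzx hy⟩
  constructor
  · intro z hz
    obtain ⟨x, _, hzx, huniq⟩ := single z hz
    refine ⟨x, ?_⟩
    ext y
    constructor
    · intro hy; exact huniq y hy
    · intro hy
      rw [Set.mem_singleton_iff] at hy
      rw [hy]; exact hzx
  · intro z z' hz hz' hne x x' hzx hzx'
    have hx : x ∈ innerSet Ω δ := by
      obtain ⟨x₀, hx₀, _, hu⟩ := single z hz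
      rw [hu x hzx]; exact hx₀
    have hx' : x' ∈ innerSet Ω δ := by
      obtain ⟨x₀, hx₀, _, hu⟩ := single z' hz'
      rw [hu x' hzx']; exact hx₀
    have hball := closedBall_subset_of_inner hδ hΩ hx
    obtain ⟨hL0, hq⟩ := q_lower h1 h2 hδ hT hM hL x z hball hzx
    have hw0 : 0 < dist z z' := dist_pos.2 hne
    have hS0 : 0 < Real.sqrt (l₁ * l₂) := Real.sqrt_pos.2 (mul_pos h1 h2)
    have hrD : dist x x' ≤ D' := by
      have := dist_le_diam_of_mem hbd hx.1 hx'.1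
      rw [hdiam] at this
      have := le_abs_self D
      linarith
    have hin : ⟪z' - z, x' - x⟫ ≤ dist z z' * dist x x' := by
      rw [dist_comm z, dist_comm x, dist_eq_norm, dist_eq_norm]
      exact real_inner_le_norm _ _
    set S := Real.sqrt (l₁ * l₂) with hS
    set w := dist z z' with hw
    set Y := 1 / (C * S * w) with hY
    have hY0 : 0 < Y := by positivity
    have hlog : 0 < Real.log (1 + Y) := Real.log_pos (by linarith)
    have hell : 0 < Real.log (1 + Y) ^ ((1 : ℝ) / 8) := Real.rpow_pos_of_pos hlog _
    rcases eq_or_ne x' x with hxx | hxx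
    · rw [hxx, dist_self]
      positivity
    have hr0 : 0 < dist x x' := dist_pos.2 hxx.symm
    set d := δ / (2 * D') * dist x x' with hd
    have hd0 : 0 < d := by positivity
    have hdδ : d ≤ δ / 2 := by
      rw [hd, div_mul_eq_mul_div, div_le_div_iff₀ (by positivity) (by norm_num)]
      nlinarith
    set q := S * L with hqd
    have hq0 : 0 < q := by positivity
    have hqd1 : 1 ≤ q / d := by rw [one_le_div hd0]; linarith
    set ε := w * D' with hε
    set τ := ε / L with hτ
    have hτ0 : 0 < τ := by positivity
    set X := δ / 2 / τ with hX
    have hX0 : 0 < X := by positivity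
    have hεb : ψ x' - ψ x - ⟪z, x' - x⟫ ≤ ε := by
      have k := hzx' x
      rw [inner_sub_left, inner_sub_right z'] at hin
      rw [inner_sub_right z'] at k
      have : w * dist x x' ≤ w * D' := by gcongr
      linarith
    have hlogX : Real.log (1 + X) ≤ 41092 * (q / d) ^ 2 := by
      have hqd2 : 1 ≤ (q / d) ^ 2 := one_le_pow₀ hqd1
      rcases le_or_gt 1 X with hX1 | hX1
      · obtain ⟨K, hK1, hK2⟩ := exists_nat_pow_near hX1 (by norm_num : (1 : ℝ) < 3)
        have hKτ : 3 ^ K * τ ≤ δ / 2 := by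
          rw [hX, le_div_iff₀ hτ0] at hK1
          exact hK1
        have mb := main_bound (D' := D') h1 h2 hδ hψ hT hM hL x x' z hball hzx hxx hDδ hrD
          (by positivity) hεb hτ0 (by rw [hτ, mul_div_cancel₀ _ hL0.ne']) hKτ
        have hKb : (K : ℝ) ≤ 20544 * (q / d) ^ 2 := by
          rw [div_pow, ← mul_div_assoc, le_div_iff₀ (by positivity)]
          exact mb
        have h3 : 1 + X ≤ 3 ^ (K + 2) := by
          have : (3 : ℝ) ^ (K + 2) = 3 * 3 ^ (K + 1) := by ring
          linarith
        have h4 := Real.log_le_log (by linarith) h3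
        rw [Real.log_pow] at h4
        have h5 : Real.log 3 ≤ 2 := by
          have := Real.log_le_sub_one_of_pos (by norm_num : (0 : ℝ) < 3)
          linarith
        have h6 : ((K + 2 : ℕ) : ℝ) * Real.log 3 ≤ ((K + 2 : ℕ) : ℝ) * 2 := by gcongr
        push_cast at h4 h6
        linarith
      · have := Real.log_le_sub_one_of_pos (by linarith : 0 < 1 + X)
        linarith
    have hYX : Y ≤ X := by
      have e : X = δ * L / (2 * (w * D')) := by rw [hX, hτ, hε]; field_simp
      rw [e, hY, div_le_div_iff₀ (by positivity) (by positivity)]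
      have c1 : 4 * D' / δ ^ 2 ≤ C := by
        have : 0 < 41092 * (2 * D' / δ) := by positivity
        linarith
      have c2 : 2 * D' ≤ C * q * δ := by
        calc 2 * D' = 4 * D' / δ ^ 2 * (δ / 2) * δ := by field_simp; ring
          _ ≤ C * q * δ := by gcongr
      calc 1 * (2 * (w * D')) = (2 * D') * w := by ring
        _ ≤ (C * q * δ) * w := by gcongr
        _ = δ * L * (C * S * w) := by rw [hqd]; ring
    have hlogY : Real.log (1 + Y) ≤ (41092 * (q / d)) ^ (8 : ℕ) := by
      have a1 : Real.log (1 + Y) ≤ Real.log (1 + X) := Real.log_le_log (by linarith) (by linarith)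
      have a2 : (q / d) ^ 2 ≤ (q / d) ^ 8 := pow_le_pow_right₀ hqd1 (by norm_num)
      have a3 : 0 ≤ (q / d) ^ 8 := by positivity
      rw [mul_pow]
      have a4 : (41092 : ℝ) ≤ 41092 ^ 8 := by norm_num
      calc Real.log (1 + Y) ≤ 41092 * (q / d) ^ 2 := a1.trans hlogX
        _ ≤ 41092 * (q / d) ^ 8 := by gcongr
        _ ≤ 41092 ^ 8 * (q / d) ^ 8 := by gcongr
    have hellb : Real.log (1 + Y) ^ ((1 : ℝ) / 8) ≤ 41092 * (q / d) := by
      have := Real.rpow_le_rpow hlog.le hlogY (by norm_num : (0 : ℝ) ≤ 1 / 8)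
      refine this.trans (le_of_eq ?_)
      rw [← Real.rpow_natCast, ← Real.rpow_mul (by positivity)]
      norm_num
    rw [le_div_iff₀ hell]
    have c3 : 41092 * (2 * D' / δ) ≤ C := by
      have : 0 < 4 * D' / δ ^ 2 := by positivity
      linarith
    calc dist x x' * Real.log (1 + Y) ^ ((1 : ℝ) / 8) ≤ dist x x' * (41092 * (q / d)) := by gcongr
      _ = 41092 * (2 * D' / δ) * q := by rw [hd]; field_simp
      _ ≤ C * q := by gcongr
      _ = C * S * L := by rw [hqd]; ring
end
end

section
/- There exists a universal constant C > 0 such that the following holds. Let ψ : ℝ² → ℝ be convex with ψ(a) = ψ(b) = 0 and 0 ∈ ∂ψ(x₀) for some x₀ on the segment [a,b], where a = (−ℓ,0), b = (ℓ,0), ℓ > 0, δ > 0; set ε := −min_{t∈[0,1]} ψ((1−t)a + tb) ≥ 0 and let K > 0 satisfy |z| ≤ K for every z ∈ ∂ψ(y) with y ∈ [−ℓ/2, ℓ/2] × [0, 2δ]. Then for every γ > 0 with γ ≥ ε/K, ∫_{R_δ} ∫_{R_δ} |T⊥(y) − T⊥(x)| · φ_γ(x,y) dy dx ≤ C K ℓ²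 ( (log(1 + δ/γ))^{1/2} + 1 ). -/
open MeasureTheory Set Metric Filter
open scoped RealInnerProductSpace ENNReal

noncomputable section

/-- `R_δ = [−ℓ/2, ℓ/2] × [0, δ]`. -/
def Rbox (ℓ δ : ℝ) : Set E2 := {p : E2 | p 0 ∈ Icc (-(ℓ / 2)) (ℓ / 2) ∧ p 1 ∈ Icc 0 δ}

/-- `φ_γ(x,y) = (x⊥ + γ)⁻² · 1_{x⊥/2 ≤ y⊥ ≤ 2x⊥}`. -/
def phiWeight (γ : ℝ) (x y : E2) : ℝ :=
  if x 1 / 2 ≤ y 1 ∧ y 1 ≤ 2 * x 1 then ((x 1 + γ) ^ 2)⁻¹ else 0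

def qq (F : ℝ → ℝ → ℝ) (s h : ℝ) : ℝ := (F s (2 * h) - F s h) / h

def VV (F : ℝ → ℝ → ℝ) (s h : ℝ) : ℝ := qq F s (2 * h) - qq F s (h / 4)

lemma slope_le_slope {f : ℝ → ℝ} (hf : ConvexOn ℝ univ f) {a b c d : ℝ} (hab : a < b)
    (hcd : c < d) (hac : a ≤ c) (hbd : b ≤ d) :
    (f b - f a) / (b - a) ≤ (f d - f c) / (d - c) := by
  have had : a < d := lt_of_lt_of_le hab hbd
  have h1 : (f b - f a) / (b - a) ≤ (f d - f a) / (d - a) :=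
    hf.secant_mono (mem_univ _) (mem_univ _) (mem_univ _) hab.ne' had.ne' hbd
  have h2 : (f a - f d) / (a - d) ≤ (f c - f d) / (c - d) :=
    hf.secant_mono (mem_univ _) (mem_univ _) (mem_univ _) had.ne hcd.ne hac
  have e1 : (f a - f d) / (a - d) = (f d - f a) / (d - a) := by
    rw [← neg_div_neg_eq]; simp
  have e2 : (f c - f d) / (c - d) = (f d - f c) / (d - c) := by
    rw [← neg_div_neg_eq]; simp
  rw [e1, e2] at h2
  exact h1.trans h2

lemma cvx_vert {F : ℝ → ℝ → ℝ} (hF : ConvexOn ℝ univ (fun p : ℝ × ℝ => F p.1 p.2)) (s : ℝ) :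
    ConvexOn ℝ univ (F s) := by
  refine ⟨convex_univ, fun x _ y _ a b ha hb hab => ?_⟩
  have := hF.2 (mem_univ (s, x)) (mem_univ (s, y)) ha hb hab
  simp only [Prod.smul_mk, Prod.mk_add_mk, smul_eq_mul] at this ⊢
  have e : a * s + b * s = s := by rw [← add_mul, hab, one_mul]
  rwa [e] at this

lemma cvx_hor {F : ℝ → ℝ → ℝ} (hF : ConvexOn ℝ univ (fun p : ℝ × ℝ => F p.1 p.2)) (s s' h : ℝ) :
    ConvexOn ℝ univ (fun u : ℝ => F (s + u * (s' - s)) h) := by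
  refine ⟨convex_univ, fun x _ y _ a b ha hb hab => ?_⟩
  have := hF.2 (mem_univ (s + x * (s' - s), h)) (mem_univ (s + y * (s' - s), h)) ha hb hab
  simp only [Prod.smul_mk, Prod.mk_add_mk, smul_eq_mul] at this ⊢
  have e : a * h + b * h = h := by rw [← add_mul, hab, one_mul]
  have e2 : a * (s + x * (s' - s)) + b * (s + y * (s' - s)) = s + (a * x + b * y) * (s' - s) := by
    linear_combination s * hab
  rwa [e, e2] at this

lemma cvx_mid {F : ℝ → ℝ → ℝ} (hF : ConvexOn ℝ univ (fun p : ℝ × ℝ => F p.1 p.2))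
    (s s' h h' : ℝ) : 2 * F ((s + s') / 2) ((h + h') / 2) ≤ F s h + F s' h' := by
  have := hF.2 (mem_univ (s, h)) (mem_univ (s', h')) 
    (by norm_num : (0 : ℝ) ≤ 1 / 2) (by norm_num : (0 : ℝ) ≤ 1 / 2) (by norm_num)
  simp only [Prod.smul_mk, Prod.mk_add_mk, smul_eq_mul] at this
  have e : 1 / 2 * s + 1 / 2 * s' = (s + s') / 2 := by ring
  have e2 : 1 / 2 * h + 1 / 2 * h' = (h + h') / 2 := by ring
  rw [e, e2] at this
  linarith

lemma qq_mono {F : ℝ → ℝ → ℝ} (hF : ConvexOn ℝ univ (fun p : ℝ × ℝ => F p.1 p.2)) (s : ℝ)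
    {h h' : ℝ} (hh : 0 < h) (hh' : h ≤ h') : qq F s h ≤ qq F s h' := by
  have := slope_le_slope (cvx_vert hF s) (a := h) (b := 2 * h) (c := h') (d := 2 * h')
    (by linarith) (by linarith) hh' (by linarith)
  unfold qq
  convert this using 2 <;> ring

lemma VV_nonneg {F : ℝ → ℝ → ℝ} (hF : ConvexOn ℝ univ (fun p : ℝ × ℝ => F p.1 p.2)) (s : ℝ)
    {h : ℝ} (hh : 0 < h) : 0 ≤ VV F s h := by
  have := qq_mono hF s (h := h / 4) (h' := 2 * h) (by linarith) (by linarith)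
  unfold VV; linarith

/-- one chain step -/
lemma step_le {F : ℝ → ℝ → ℝ} (hF : ConvexOn ℝ univ (fun p : ℝ × ℝ => F p.1 p.2))
    (s s' h : ℝ) (hh : 0 < h) :
    qq F s (h / 4) - qq F s' (2 * h) ≤
      2 / h * (F s h + F s' h - 2 * F ((s + s') / 2) h) := by
  have h1 := slope_le_slope (cvx_vert hF s) (a := h / 4) (b := h / 2) (c := h / 2) (d := h)
    (by linarith) (by linarith) (by linarith) (by linarith)
  have h2 := slope_le_slope (cvx_vert hF s') (a := h) (b := 3 * h / 2) (c := 2 * h) (d := 4 * h)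
    (by linarith) (by linarith) (by linarith) (by linarith)
  have h3 := cvx_mid hF s s' (h / 2) (3 * h / 2)
  have e3 : (h / 2 + 3 * h / 2) / 2 = h := by ring
  rw [e3] at h3
  have e1 : qq F s (h / 4) = (F s (h / 2) - F s (h / 4)) / (h / 2 - h / 4) := by
    unfold qq; congr 1 <;> ring_nf
  have e2 : qq F s' (2 * h) = (F s' (4 * h) - F s' (2 * h)) / (4 * h - 2 * h) := by
    unfold qq; congr 1 <;> ring_nf
  rw [e1, e2]
  refine (sub_le_sub h1 h2).trans ?_
  have e4 : h - h / 2 = h / 2 := by ring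
  have e5 : 3 * h / 2 - h = h / 2 := by ring
  rw [e4, e5, ← sub_div, div_eq_mul_inv, inv_div, mul_comm]
  refine mul_le_mul_of_nonneg_left ?_ (by positivity)
  linarith

lemma chain_id (M m : ℕ → ℝ) (n : ℕ) :
    M 0 - m n = ∑ i ∈ Finset.range (n + 1), (M i - m i)
      + ∑ i ∈ Finset.range n, (m i - M (i + 1)) := by
  induction n with
  | zero => simp
  | succ k ih =>
    rw [Finset.sum_range_succ _ (k + 1), Finset.sum_range_succ (fun i => m i - M (i + 1)) k]
    linarith

lemma chain_id' (M m : ℕ → ℝ) (n : ℕ) :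
    M n - m 0 = ∑ i ∈ Finset.range (n + 1), (M i - m i)
      + ∑ i ∈ Finset.range n, (m (i + 1) - M i) := by
  induction n with
  | zero => simp
  | succ k ih =>
    rw [Finset.sum_range_succ _ (k + 1), Finset.sum_range_succ (fun i => m (i + 1) - M i) k]
    linarith

lemma second_diff_sum {k : ℝ → ℝ} (hk : ConvexOn ℝ univ k) {n : ℕ} (hn : 2 ≤ n) {B : ℝ}
    (h1 : k (5 / 4) - k 1 ≤ B) (h2 : k (-1 / 4) - k 0 ≤ B) :
    ∑ i ∈ Finset.range n, (k (i / n) + k ((i + 1 : ℕ) / n) - 2 * k ((2 * i + 1) / (2 * n)))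
      ≤ 4 * B / n := by
  have hn0 : (0 : ℝ) < n := by exact_mod_cast (by omega : 0 < n)
  have hn2 : (2 : ℝ) ≤ n := by exact_mod_cast hn
  set e : ℕ → ℝ := fun i => k ((2 * i + 1) / (2 * n)) - k (i / n) with he
  have key : ∀ i ∈ Finset.range n,
      (k (i / n) + k ((i + 1 : ℕ) / n) - 2 * k ((2 * i + 1) / (2 * n))) ≤ e (i + 1) - e i := by
    intro i _
    have := slope_le_slope hk (a := (2 * i + 1) / (2 * n)) (b := (i + 1) / n) (c := (i + 1) / n)
      (d := (2 * (i + 1) + 1) / (2 * n)) (by rw [div_lt_div_iff₀ (by positivity) hn0]; nlinarith)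
      (by rw [div_lt_div_iff₀ hn0 (by positivity)]; nlinarith)
      (by rw [div_le_div_iff₀ (by positivity) hn0]; nlinarith)
      (by rw [div_le_div_iff₀ hn0 (by positivity)]; nlinarith)
    have e1 : ((i : ℝ) + 1) / n - (2 * i + 1) / (2 * n) = 1 / (2 * n) := by field_simp; ring
    have e2 : (2 * ((i : ℝ) + 1) + 1) / (2 * n) - (i + 1) / n = 1 / (2 * n) := by field_simp; ring
    rw [e1, e2, div_le_div_iff_of_pos_right (by positivity)] at this
    simp only [he]
    push_cast
    linarith
  refine (Finset.sum_le_sum key).trans ?_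
  rw [Finset.sum_range_sub]
  have a1 : e n ≤ 2 * B / n := by
    have hl : (1 : ℝ) < (2 * n + 1) / (2 * n) := by
      rw [lt_div_iff₀ (by positivity)]; linarith
    have hl2 : (2 * (n : ℝ) + 1) / (2 * n) ≤ 5 / 4 := by
      rw [div_le_div_iff₀ (by positivity) (by norm_num)]; linarith
    have := slope_le_slope hk (a := 1) (b := (2 * n + 1) / (2 * n)) (c := 1) (d := 5 / 4)
      hl (by norm_num) le_rfl hl2
    have e1 : (2 * (n : ℝ) + 1) / (2 * n) - 1 = 1 / (2 * n) := by field_simp; ring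
    rw [e1, div_le_iff₀ (by positivity)] at this
    simp only [he]
    rw [div_self hn0.ne']
    refine this.trans ?_
    have : (k (5 / 4) - k 1) / (5 / 4 - 1) * (1 / (2 * n)) = 2 * (k (5 / 4) - k 1) / n := by
      field_simp; ring
    rw [this]
    gcongr
  have a2 : -e 0 ≤ 2 * B / n := by
    have hl : (0 : ℝ) < 1 / (2 * n) := by positivity
    have := slope_le_slope hk (a := -1 / 4) (b := 0) (c := 0) (d := 1 / (2 * n))
      (by norm_num) hl (by norm_num) hl.le
    rw [sub_zero, le_div_iff₀ (by positivity)] at this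
    simp only [he]
    simp only [Nat.cast_zero, mul_zero, zero_add, zero_div]
    have e3 : (k 0 - k (-1 / 4)) / (0 - -1 / 4) * (1 / (2 * n)) = - (2 * (k (-1 / 4) - k 0) / n) := by
      field_simp; ring
    rw [e3] at this
    have : 2 * (k (-1 / 4) - k 0) / n ≤ 2 * B / n := by gcongr
    linarith
  have : 4 * B / n = 2 * B / n + 2 * B / n := by ring
  linarith

/-- pointwise estimate -/
lemma pointwise_bound {F : ℝ → ℝ → ℝ} (hF : ConvexOn ℝ univ (fun p : ℝ × ℝ => F p.1 p.2))
    {n : ℕ} (hn : 2 ≤ n) {ℓ K h h' s s' p p' : ℝ} (hh : 0 < h)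
    (hbd : ∀ t, |t| ≤ 3 * ℓ / 4 → -(K * h) ≤ F t h ∧ F t h ≤ K * h)
    (hs : |s| ≤ ℓ / 2) (hs' : |s'| ≤ ℓ / 2) (h1 : h / 2 ≤ h') (h2 : h' ≤ 2 * h)
    (hp : ∀ t, p * t ≤ F s (h + t) - F s h) (hp' : ∀ t, p' * t ≤ F s' (h' + t) - F s' h') :
    |p' - p| ≤ ∑ i ∈ Finset.range (n + 1), VV F (s + i / n * (s' - s)) h + 16 * K / n := by
  have hn0 : (0 : ℝ) < n := by exact_mod_cast (by omega : 0 < n)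
  have gen : ∀ (s h' p : ℝ), h / 2 ≤ h' → h' ≤ 2 * h → (∀ t, p * t ≤ F s (h' + t) - F s h') →
      qq F s (h / 4) ≤ p ∧ p ≤ qq F s (2 * h) := by
    intro s h' p h1 h2 hp
    constructor
    · have a := slope_le_slope (cvx_vert hF s) (a := h / 4) (b := h / 2) (c := h / 4) (d := h')
        (by linarith) (by linarith) le_rfl h1
      have b := hp (h / 4 - h')
      have e1 : qq F s (h / 4) = (F s (h / 2) - F s (h / 4)) / (h / 2 - h / 4) := by
        unfold qq; congr 1 <;> ring_nf
      rw [e1]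
      refine a.trans ?_
      rw [div_le_iff₀ (by linarith)]
      rw [add_sub_cancel] at b
      linarith
    · have a := slope_le_slope (cvx_vert hF s) (a := h') (b := 4 * h) (c := 2 * h) (d := 4 * h)
        (by linarith) (by linarith) h2 le_rfl
      have b := hp (4 * h - h')
      have e2 : qq F s (2 * h) = (F s (4 * h) - F s (2 * h)) / (4 * h - 2 * h) := by
        unfold qq; congr 1 <;> ring_nf
      rw [e2]
      refine le_trans ?_ a
      rw [le_div_iff₀ (by linarith)]
      rw [add_sub_cancel] at b
      linarith
  obtain ⟨g1, g2⟩ := gen s h p (by linarith) (by linarith) hp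
  obtain ⟨g3, g4⟩ := gen s' h' p' h1 h2 hp'
  set k : ℝ → ℝ := fun u : ℝ => F (s + u * (s' - s)) h with hk
  have kc : ConvexOn ℝ univ k := cvx_hor hF s s' h
  have hs1 := abs_le.1 hs
  have hs2 := abs_le.1 hs'
  have kb : ∀ u, -1 / 4 ≤ u → u ≤ 5 / 4 → -(K * h) ≤ k u ∧ k u ≤ K * h := by
    intro u hu1 hu2
    apply hbd
    rw [abs_le]
    constructor <;>
    nlinarith [mul_nonneg (sub_nonneg.2 hu1) (sub_nonneg.2 hs2.1),
      mul_nonneg (sub_nonneg.2 hu1) (sub_nonneg.2 hs2.2),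
      mul_nonneg (sub_nonneg.2 hu2) (sub_nonneg.2 hs1.1),
      mul_nonneg (sub_nonneg.2 hu2) (sub_nonneg.2 hs1.2)]
  have sd := second_diff_sum kc hn (B := 2 * (K * h))
    (by linarith [(kb (5 / 4) (by norm_num) (by norm_num)).2, (kb 1 (by norm_num) (by norm_num)).1])
    (by linarith [(kb (-1 / 4) (by norm_num) (by norm_num)).2, (kb 0 (by norm_num) (by norm_num)).1])
  set M : ℕ → ℝ := fun i => qq F (s + i / n * (s' - s)) (2 * h) with hM
  set m : ℕ → ℝ := fun i => qq F (s + i / n * (s' - s)) (h / 4) with hm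
  set d : ℕ → ℝ := fun i => (k (i / n) + k ((i + 1 : ℕ) / n) - 2 * k ((2 * i + 1) / (2 * n))) with hd
  have mid : ∀ i : ℕ, ((s + i / n * (s' - s)) + (s + (i + 1 : ℕ) / n * (s' - s))) / 2
      = s + (2 * i + 1) / (2 * n) * (s' - s) := by
    intro i; push_cast; field_simp; ring
  have c1 : ∀ i, m i - M (i + 1) ≤ 2 / h * d i := by
    intro i
    have := step_le hF (s + i / n * (s' - s)) (s + (i + 1 : ℕ) / n * (s' - s)) h hh
    rw [mid] at this
    exact this
  have c2 : ∀ i, m (i + 1) - M i ≤ 2 / h * d i := by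
    intro i
    have := step_le hF (s + (i + 1 : ℕ) / n * (s' - s)) (s + i / n * (s' - s)) h hh
    rw [add_comm (s + (i + 1 : ℕ) / n * (s' - s)), mid] at this
    refine this.trans (le_of_eq ?_)
    simp only [hd, hk]; ring
  have sdd : ∑ i ∈ Finset.range n, 2 / h * d i ≤ 16 * K / n := by
    rw [← Finset.mul_sum]
    refine (mul_le_mul_of_nonneg_left sd (by positivity)).trans (le_of_eq ?_)
    field_simp; ring
  have S1 := (Finset.sum_le_sum (fun i (_ : i ∈ Finset.range n) => c1 i)).trans sdd
  have S2 := (Finset.sum_le_sum (fun i (_ : i ∈ Finset.range n) => c2 i)).trans sdd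
  have I1 := chain_id M m n
  have I2 := chain_id' M m n
  have M0 : M 0 = qq F s (2 * h) := by simp [hM]
  have m0 : m 0 = qq F s (h / 4) := by simp [hm]
  have Mn : M n = qq F s' (2 * h) := by simp [hM, div_self hn0.ne']
  have mn : m n = qq F s' (h / 4) := by simp [hm, div_self hn0.ne']
  have SV : ∑ i ∈ Finset.range (n + 1), VV F (s + i / n * (s' - s)) h =
    ∑ i ∈ Finset.range (n + 1), (M i - m i) := rfl
  rw [SV, abs_le]
  constructor <;> linarith

lemma grad_mem_subdiff {ψ : E2 → ℝ} (hψ : ConvexOn ℝ univ ψ) {x : E2}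
    (hd : DifferentiableAt ℝ ψ x) : gradient ψ x ∈ subdiff ψ x := by
  intro y
  have hc : ConvexOn ℝ univ (fun t : ℝ => ψ (x + t • (y - x))) := by
    refine ⟨convex_univ, fun a _ b _ c d hc hd hcd => ?_⟩
    have := hψ.2 (mem_univ (x + a • (y - x))) (mem_univ (x + b • (y - x))) hc hd hcd
    refine le_trans (le_of_eq ?_) this
    dsimp only
    congr 1
    rw [smul_add, smul_add, smul_smul, smul_smul, smul_eq_mul, smul_eq_mul, add_smul]
    have : x = c • x + d • x := by rw [← add_smul, hcd, one_smul]
    nth_rewrite 1 [this]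
    abel
  have hder : HasDerivAt (fun t : ℝ => ψ (x + t • (y - x))) (fderiv ℝ ψ x (y - x)) 0 := by
    have h1 : HasDerivAt (fun t : ℝ => x + t • (y - x)) (y - x) 0 := by
      have := ((hasDerivAt_id (0 : ℝ)).smul_const (y - x)).const_add x
      simpa using this
    have h2 : HasFDerivAt ψ (fderiv ℝ ψ x) (x + (0 : ℝ) • (y - x)) := by
      simpa using hd.hasFDerivAt
    exact h2.comp_hasDerivAt (0 : ℝ) h1
  have := hc.le_slope_of_hasDerivAt (mem_univ (0 : ℝ)) (mem_univ (1 : ℝ)) one_pos hder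
  rw [slope_def_field] at this
  simp only [zero_smul, add_zero, one_smul, sub_zero, div_one, add_sub_cancel] at this
  have e : ⟪gradient ψ x, y - x⟫ = fderiv ℝ ψ x (y - x) := by
    simp [gradient]
  rw [e]; linarith

lemma ae_diff {ψ : E2 → ℝ} (hψ : ConvexOn ℝ univ ψ) :
    ∀ᵐ x : E2, DifferentiableAt ℝ ψ x := by
  have hl := hψ.locallyLipschitz
  rw [ae_iff]
  apply measure_null_of_locally_null
  intro x _
  obtain ⟨C, t, ht, hL⟩ := hl x
  have h1 := hL.ae_differentiableWithinAt_of_mem (μ := volume)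
  refine ⟨{a | ¬ DifferentiableAt ℝ ψ a} ∩ interior t,
    inter_mem self_mem_nhdsWithin (mem_nhdsWithin_of_mem_nhds (interior_mem_nhds.2 ht)), ?_⟩
  rw [ae_iff] at h1
  refine measure_mono_null ?_ h1
  rintro a ⟨ha, hat⟩ h
  exact ha ((h (interior_subset hat)).differentiableAt (mem_interior_iff_mem_nhds.1 hat))

lemma one_sided_lip {ψ : E2 → ℝ} (hψ : ConvexOn ℝ univ ψ) {ℓ δ K : ℝ} (hℓ : 0 < ℓ) (hδ : 0 < δ)
    (hK : ∀ y : E2, |y 0| ≤ ℓ / 2 → y 1 ∈ Icc 0 (2 * δ) → ∀ z ∈ subdiff ψ y, ‖z‖ ≤ K)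
    (x y : E2) (hx : |x 0| ≤ ℓ / 2) (hx1 : x 1 ∈ Icc 0 (2 * δ)) :
    ψ x ≤ ψ y + K * ‖x - y‖ := by
  have hcont : Continuous ψ := hψ.locallyLipschitz.continuous
  set S : Set E2 := {x | ψ x ≤ ψ y + K * ‖x - y‖} with hS
  have hSc : IsClosed S := by
    apply isClosed_le hcont
    fun_prop
  set O : Set E2 := {x | |x 0| < ℓ / 2 ∧ 0 < x 1 ∧ x 1 < 2 * δ} with hO
  have hOo : IsOpen O := by
    have h0 : Continuous fun x : E2 => x 0 := by fun_prop
    have h1 : Continuous fun x : E2 => x 1 := by fun_prop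
    exact (isOpen_lt h0.abs continuous_const).inter
      ((isOpen_lt continuous_const h1).inter (isOpen_lt h1 continuous_const))
  have hD : Dense {x : E2 | DifferentiableAt ℝ ψ x} := Measure.dense_of_ae (ae_diff hψ)
  have hOD : O ∩ {x : E2 | DifferentiableAt ℝ ψ x} ⊆ S := by
    rintro u ⟨hu, hd⟩
    have hg := grad_mem_subdiff hψ hd
    have hn := hK u hu.1.le ⟨hu.2.1.le, hu.2.2.le⟩ _ hg
    have h1 := hg y
    have h2 := abs_le.1 (abs_real_inner_le_norm (gradient ψ u) (y - u))
    have h3 : ‖gradient ψ u‖ * ‖y - u‖ ≤ K * ‖y - u‖ := by gcongr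
    rw [norm_sub_rev y u] at *
    show ψ u ≤ ψ y + K * ‖u - y‖
    linarith [h2.1]
  have hOS : closure O ⊆ S :=
    closure_minimal ((hD.open_subset_closure_inter hOo).trans (closure_minimal hOD hSc)) hSc
  apply hOS
  set c : E2 := !₂[0, δ] with hc
  have ht : Tendsto (fun t : ℝ => (1 - t) • x + t • c) (nhdsWithin 0 (Ioi 0)) (nhds x) := by
    have : Continuous (fun t : ℝ => (1 - t) • x + t • c) := by fun_prop
    have := this.tendsto 0
    simp only [sub_zero, one_smul, zero_smul, add_zero] at this
    exact this.mono_left nhdsWithin_le_nhds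
  refine mem_closure_of_tendsto ht ?_
  filter_upwards [Ioo_mem_nhdsGT (one_pos : (0 : ℝ) < 1)] with t ht
  obtain ⟨t0, t1⟩ := ht
  have e0 : ((1 - t) • x + t • c) 0 = (1 - t) * x 0 := by simp [hc]
  have e1 : ((1 - t) • x + t • c) 1 = (1 - t) * x 1 + t * δ := by simp [hc]
  have hx' := abs_le.1 hx
  refine ⟨?_, ?_, ?_⟩
  · rw [e0, abs_mul, abs_of_pos (by linarith)]
    nlinarith [abs_nonneg (x 0)]
  · rw [e1]; nlinarith [hx1.1, mul_nonneg (sub_nonneg.2 t1.le) hx1.1]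
  · rw [e1]; nlinarith [hx1.2, mul_nonneg (sub_nonneg.2 t1.le) (sub_nonneg.2 hx1.2)]

/-- the coordinates version of a function on the plane -/
def co (ψ : E2 → ℝ) (s h : ℝ) : ℝ := ψ !₂[s, h]

lemma co_eta (x : E2) : (!₂[x 0, x 1] : E2) = x := by
  ext i; fin_cases i <;> simp

lemma co_convex {ψ : E2 → ℝ} (hψ : ConvexOn ℝ univ ψ) :
    ConvexOn ℝ univ (fun p : ℝ × ℝ => co ψ p.1 p.2) := by
  refine ⟨convex_univ, fun x _ y _ a b ha hb hab => ?_⟩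
  have := hψ.2 (mem_univ (!₂[x.1, x.2])) (mem_univ (!₂[y.1, y.2])) ha hb hab
  refine le_trans (le_of_eq ?_) this
  change ψ !₂[(a • x + b • y).1, (a • x + b • y).2] = ψ _
  congr 1
  ext i; fin_cases i <;> simp

lemma co_cont {ψ : E2 → ℝ} (hψ : ConvexOn ℝ univ ψ) :
    Continuous (fun p : ℝ × ℝ => co ψ p.1 p.2) :=
  (co_convex hψ).locallyLipschitz.continuous

lemma co_vert_lip {ψ : E2 → ℝ} (hψ : ConvexOn ℝ univ ψ) {ℓ δ K : ℝ} (hℓ : 0 < ℓ) (hδ : 0 < δ)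
    (hK : ∀ y : E2, |y 0| ≤ ℓ / 2 → y 1 ∈ Icc 0 (2 * δ) → ∀ z ∈ subdiff ψ y, ‖z‖ ≤ K)
    (s h h' : ℝ) (hs : |s| ≤ ℓ / 2) (hh : h ∈ Icc 0 (2 * δ)) :
    co ψ s h ≤ co ψ s h' + K * |h - h'| := by
  have := one_sided_lip hψ hℓ hδ hK !₂[s, h] !₂[s, h'] (by simpa using hs) (by simpa using hh)
  refine this.trans (le_of_eq ?_)
  have : ‖(!₂[s, h] - !₂[s, h'] : E2)‖ = |h - h'| := by
    rw [EuclideanSpace.norm_eq]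
    simp [Real.sqrt_sq_eq_abs]
  rw [this]; rfl

lemma grad_vert {ψ : E2 → ℝ} (hψ : ConvexOn ℝ univ ψ) {x : E2}
    (hd : DifferentiableAt ℝ ψ x) (t : ℝ) :
    gradient ψ x 1 * t ≤ co ψ (x 0) (x 1 + t) - co ψ (x 0) (x 1) := by
  have := grad_mem_subdiff hψ hd !₂[x 0, x 1 + t]
  have e : ⟪gradient ψ x, (!₂[x 0, x 1 + t] : E2) - x⟫ = gradient ψ x 1 * t := by
    rw [EuclideanSpace.inner_eq_star_dotProduct]
    simp [dotProduct, Fin.sum_univ_two, mul_comm]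
  rw [e] at this
  unfold co
  rw [co_eta]
  linarith

lemma grad_abs {ψ : E2 → ℝ} {ℓ δ K : ℝ} (hψ : ConvexOn ℝ univ ψ) 
    (hK : ∀ y : E2, |y 0| ≤ ℓ / 2 → y 1 ∈ Icc 0 (2 * δ) → ∀ z ∈ subdiff ψ y, ‖z‖ ≤ K) 
    {x : E2} (hd : DifferentiableAt ℝ ψ x) (hx : |x 0| ≤ ℓ / 2) (hx1 : x 1 ∈ Icc 0 (2 * δ)) :
    |gradient ψ x 1| ≤ K := 
  (PiLp.norm_apply_le (gradient ψ x) 1).trans (hK x hx hx1 _ (grad_mem_subdiff hψ hd))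

lemma lint_E2 {ℓ δ : ℝ} (G : ℝ → ℝ → ℝ≥0∞) (hG : Measurable (fun p : ℝ × ℝ => G p.1 p.2)) :
    ∫⁻ x in Rbox ℓ δ, G (x 0) (x 1) =
      ∫⁻ h in Icc 0 δ, ∫⁻ s in Icc (-(ℓ / 2)) (ℓ / 2), G s h := by
  have mp1 := PiLp.volume_preserving_ofLp (Fin 2)
  have mp2 := volume_preserving_finTwoArrow ℝ
  have mp := mp2.comp mp1
  have hset : MeasurableSet ((Icc (-(ℓ / 2)) (ℓ / 2)) ×ˢ (Icc 0 δ) : Set (ℝ × ℝ)) :=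
    measurableSet_Icc.prod measurableSet_Icc
  have := mp.setLIntegral_comp_preimage hset hG
  have e : Rbox ℓ δ = (MeasurableEquiv.finTwoArrow ∘ WithLp.ofLp) ⁻¹'
      ((Icc (-(ℓ / 2)) (ℓ / 2)) ×ˢ (Icc 0 δ) : Set (ℝ × ℝ)) := by
    ext x; simp [Rbox, MeasurableEquiv.finTwoArrow]; tauto
  rw [e]
  refine Eq.trans ?_ (this.trans ?_)
  · rfl
  · rw [Measure.volume_eq_prod, ← Measure.prod_restrict, lintegral_prod_symm _ hG.aemeasurable]

lemma lint_affine {f : ℝ → ℝ≥0∞} (hf : Measurable f) {c s ℓ t : ℝ} (hs : |s| ≤ ℓ / 2)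
    (ht : 1 / 2 ≤ t) (ht1 : t ≤ 1) (hc : c = (1 - t) * s) :
    ∫⁻ u in Icc (-(ℓ / 2)) (ℓ / 2), f (c + t * u) ≤ 2 * ∫⁻ u in Icc (-(ℓ / 2)) (ℓ / 2), f u := by
  have h := lintegral_image_eq_lintegral_abs_deriv_mul (s := Icc (-(ℓ / 2)) (ℓ / 2))
    (f := fun u => c + t * u) (f' := fun _ => t) measurableSet_Icc
    (fun x _ => by
      have := ((hasDerivAt_id x).const_mul t).const_add c
      simpa using this.hasDerivWithinAt)
    (fun x _ y _ hxy => by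
      have : t * x = t * y := by simpa using hxy
      exact mul_left_cancel₀ (by linarith) this) f
  have hs' := abs_le.1 hs
  have hsub : (fun u => c + t * u) '' Icc (-(ℓ / 2)) (ℓ / 2) ⊆ Icc (-(ℓ / 2)) (ℓ / 2) := by
    rintro _ ⟨u, hu, rfl⟩
    obtain ⟨u1, u2⟩ := hu
    subst hc
    constructor
    · dsimp only; nlinarith
    · dsimp only; nlinarith
  have h2 : ∫⁻ u in Icc (-(ℓ / 2)) (ℓ / 2), ENNReal.ofReal |t| * f (c + t * u) ≤
      ∫⁻ u in Icc (-(ℓ / 2)) (ℓ / 2), f u := by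
    rw [← h]; exact lintegral_mono_set hsub
  calc ∫⁻ u in Icc (-(ℓ / 2)) (ℓ / 2), f (c + t * u)
      ≤ ∫⁻ u in Icc (-(ℓ / 2)) (ℓ / 2), 2 * (ENNReal.ofReal |t| * f (c + t * u)) := by
        refine lintegral_mono fun u => ?_
        rw [← mul_assoc]
        have : (1 : ℝ≥0∞) ≤ 2 * ENNReal.ofReal |t| := by
          rw [abs_of_pos (by linarith), ← ENNReal.ofReal_ofNat 2, ← ENNReal.ofReal_mul (by norm_num),
            ENNReal.one_le_ofReal]
          linarith
        exact le_mul_of_one_le_left' this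
    _ = 2 * ∫⁻ u in Icc (-(ℓ / 2)) (ℓ / 2), (ENNReal.ofReal |t| * f (c + t * u)) := by
        rw [lintegral_const_mul]; fun_prop
    _ ≤ _ := by gcongr

lemma lint_pair {f : ℝ → ℝ≥0∞} (hf : Measurable f) {ℓ t : ℝ} 
    (ht : 0 ≤ t) (ht1 : t ≤ 1) :
    ∫⁻ s in Icc (-(ℓ / 2)) (ℓ / 2), ∫⁻ s' in Icc (-(ℓ / 2)) (ℓ / 2), f (s + t * (s' - s)) ≤
      2 * ENNReal.ofReal ℓ * ∫⁻ u in Icc (-(ℓ / 2)) (ℓ / 2), f u := by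
  have fin : ∀ g : ℝ → ℝ≥0∞, (∀ s, |s| ≤ ℓ / 2 → g s ≤ 2 * ∫⁻ u in Icc (-(ℓ / 2)) (ℓ / 2), f u) →
      ∫⁻ s in Icc (-(ℓ / 2)) (ℓ / 2), g s ≤
        2 * ENNReal.ofReal ℓ * ∫⁻ u in Icc (-(ℓ / 2)) (ℓ / 2), f u := by
    intro g hg
    have hg' : ∀ s ∈ Icc (-(ℓ / 2)) (ℓ / 2), g s ≤ 2 * ∫⁻ u in Icc (-(ℓ / 2)) (ℓ / 2), f u :=
      fun s hs => hg s (abs_le.2 ⟨hs.1, hs.2⟩)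
    refine (setLIntegral_mono measurable_const hg').trans ?_
    rw [setLIntegral_const, Real.volume_Icc]
    have : ℓ / 2 - -(ℓ / 2) = ℓ := by ring
    rw [this]
    apply le_of_eq; ring
  rcases le_total (1 / 2) t with h | h
  · apply fin
    intro s hs
    refine le_trans (le_of_eq ?_) (lint_affine hf hs h ht1 rfl)
    congr 1; ext u; congr 1; ring
  · rw [lintegral_lintegral_swap (by
      apply Measurable.aemeasurable
      fun_prop)]
    apply fin
    intro s hs
    refine le_trans (le_of_eq ?_) (lint_affine hf hs (t := 1 - t) (by linarith) (by linarith) rfl)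
    congr 1; ext u; congr 1; ring

lemma int_w {q : ℝ → ℝ} (c δ K : ℝ) (hc : 0 < c) (hcδ : 2 * c ≤ δ) (hq : ∀ u, 0 < u → u ≤ δ → |q u| ≤ K) :
    |∫ u in (c / 4)..(2 * c), q u / u| ≤ 7 * K := by
  have := intervalIntegral.norm_integral_le_of_norm_le_const (a := c / 4) (b := 2 * c)
    (f := fun u => q u / u) (C := K * (4 / c)) (by
      intro u hu
      rw [uIoc_of_le (by linarith)] at hu
      have hu0 : 0 < u := by linarith [hu.1]
      have h1 := hq u hu0 (hu.2.trans hcδ)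
      rw [Real.norm_eq_abs, abs_div, abs_of_pos hu0, div_eq_mul_inv]
      have hi : u⁻¹ ≤ 4 / c := by
        rw [← inv_div]; exact inv_anti₀ (by positivity) hu.1.le
      have := abs_nonneg (q u)
      exact mul_le_mul h1 hi (by positivity) (by linarith))
  rw [Real.norm_eq_abs] at this
  refine this.trans (le_of_eq ?_)
  rw [abs_of_pos (by linarith)]
  field_simp; ring

lemma lint_V {q : ℝ → ℝ} {γ δ K : ℝ} (hγ : 0 < γ) (hqc : ContinuousOn q (Ioi 0))
    (hq : ∀ u, 0 < u → u ≤ δ → |q u| ≤ K) (hV : ∀ h, 0 < h → 0 ≤ q (2 * h) - q (h / 4)) :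
    ∫⁻ h in Icc γ (δ / 2), ENNReal.ofReal ((q (2 * h) - q (h / 4)) / h) ≤ ENNReal.ofReal (14 * K) := by
  rcases lt_or_ge (δ / 2) γ with hlt | hge
  · rw [Icc_eq_empty (not_le.2 hlt)]; simp
  have hw : ContinuousOn (fun u => q u / u) (Ioi 0) :=
    hqc.div continuousOn_id (fun x hx => (ne_of_gt hx))
  have hIntv : ∀ a b : ℝ, 0 < a → 0 < b → IntervalIntegrable (fun u => q u / u) volume a b := by
    intro a b ha hb
    apply ContinuousOn.intervalIntegrable
    apply hw.mono
    intro x hx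
    exact lt_of_lt_of_le (lt_min ha hb) hx.1
  set β := δ / 2 with hβ
  have c1 : ContinuousOn (fun h => q (2 * h) / (2 * h)) (Ioi 0) :=
    hw.comp (f := fun h : ℝ => 2 * h) (by fun_prop) (fun x hx => by
      have : (0 : ℝ) < x := hx
      show (0 : ℝ) < 2 * x; linarith)
  have c2 : ContinuousOn (fun h => q ((1 / 4) * h) / ((1 / 4) * h)) (Ioi 0) :=
    hw.comp (f := fun h : ℝ => (1 / 4) * h) (by fun_prop) (fun x hx => by
      have : (0 : ℝ) < x := hx
      show (0 : ℝ) < 1 / 4 * x; linarith)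
  have eqf : ∀ h : ℝ, (q (2 * h) - q (h / 4)) / h =
      2 * (q (2 * h) / (2 * h)) - (1 / 4) * (q ((1 / 4) * h) / ((1 / 4) * h)) := by
    intro h
    rcases eq_or_ne h 0 with rfl | hne
    · simp
    · have : (1 / 4) * h = h / 4 := by ring
      rw [this]; field_simp
  have sub : Icc γ β ⊆ Ioi 0 := fun x hx => lt_of_lt_of_le hγ hx.1
  have c3 : ContinuousOn (fun h => (q (2 * h) - q (h / 4)) / h) (Icc γ β) := by
    simp_rw [eqf]
    exact ((continuousOn_const.mul c1).sub (continuousOn_const.mul c2)).mono sub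
  rw [← ofReal_integral_eq_lintegral_ofReal (c3.integrableOn_Icc) (by
    filter_upwards [ae_restrict_mem measurableSet_Icc] with h hh
    have : 0 < h := sub hh
    exact div_nonneg (hV h this) this.le)]
  apply ENNReal.ofReal_le_ofReal
  rw [integral_Icc_eq_integral_Ioc, ← intervalIntegral.integral_of_le hge]
  simp_rw [eqf]
  have ii : ∀ {f : ℝ → ℝ}, ContinuousOn f (Ioi 0) → IntervalIntegrable f volume γ β := by
    intro f hf
    apply ContinuousOn.intervalIntegrable
    rw [uIcc_of_le hge]
    exact hf.mono sub
  rw [intervalIntegral.integral_sub ((ii c1).const_mul 2) ((ii c2).const_mul (1 / 4)),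
    intervalIntegral.integral_const_mul, intervalIntegral.integral_const_mul,
    intervalIntegral.mul_integral_comp_mul_left (f := fun u => q u / u),
    intervalIntegral.mul_integral_comp_mul_left (f := fun u => q u / u)]
  have hβ0 : 0 < β := by linarith
  have e1 := intervalIntegral.integral_add_adjacent_intervals
    (hIntv (γ / 4) (2 * γ) (by linarith) (by linarith)) (hIntv (2 * γ) (2 * β) (by linarith) (by linarith))
  have e2 := intervalIntegral.integral_add_adjacent_intervals
    (hIntv (γ / 4) (β / 4) (by linarith) (by linarith)) (hIntv (β / 4) (2 * β) (by linarith) (by linarith))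
  have b1 := abs_le.1 (int_w (q := q) γ δ K hγ (by linarith) hq)
  have b2 := abs_le.1 (int_w (q := q) β δ K hβ0 (by linarith) hq)
  have f1 : 1 / 4 * γ = γ / 4 := by ring
  have f2 : 1 / 4 * β = β / 4 := by ring
  rw [f1, f2]
  linarith [b1.1, b2.2]

lemma lint_log {γ δ : ℝ} (hγ : 0 < γ) (hδ : 0 < δ) :
    ∫⁻ h in Icc γ (δ / 2), ENNReal.ofReal (1 / h) ≤ ENNReal.ofReal (Real.log (1 + δ / γ)) := by
  rcases lt_or_ge (δ / 2) γ with hlt | hge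
  · rw [Icc_eq_empty (not_le.2 hlt)]; simp
  have sub : Icc γ (δ / 2) ⊆ Ioi 0 := fun x hx => lt_of_lt_of_le hγ hx.1
  have c3 : ContinuousOn (fun h : ℝ => 1 / h) (Icc γ (δ / 2)) :=
    continuousOn_const.div continuousOn_id (fun x hx => ne_of_gt (sub hx))
  rw [← ofReal_integral_eq_lintegral_ofReal (c3.integrableOn_Icc) (by
    filter_upwards [ae_restrict_mem measurableSet_Icc] with h hh
    have : 0 < h := sub hh
    positivity)]
  apply ENNReal.ofReal_le_ofReal
  rw [integral_Icc_eq_integral_Ioc, ← intervalIntegral.integral_of_le hge,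
    integral_one_div_of_pos hγ (by linarith)]
  apply Real.log_le_log (by positivity)
  have : δ / 2 / γ ≤ δ / γ := by gcongr; linarith
  linarith

/-- the inner majorant -/
def XX (n : ℕ) (a c : ℝ → ℝ≥0∞) (B : ℝ≥0∞) (v : ℝ → ℝ → ℝ≥0∞) (h s s' : ℝ) : ℝ≥0∞ :=
  a h + c h * (∑ i ∈ Finset.range (n + 1), v (s + i / n * (s' - s)) h + B)

lemma XX_meas {n : ℕ} {a c : ℝ → ℝ≥0∞} {B : ℝ≥0∞} {v : ℝ → ℝ → ℝ≥0∞} (ha : Measurable a)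
    (hc : Measurable c) (hv : Measurable (fun p : ℝ × ℝ => v p.1 p.2)) :
    Measurable (fun p : (ℝ × ℝ) × ℝ => XX n a c B v p.1.2 p.1.1 p.2) := by
  unfold XX
  have : ∀ i ∈ Finset.range (n + 1), Measurable
      (fun p : (ℝ × ℝ) × ℝ => v (p.1.1 + i / n * (p.2 - p.1.1)) p.1.2) := by
    intro i _
    exact hv.comp (f := fun p : (ℝ × ℝ) × ℝ => (p.1.1 + i / n * (p.2 - p.1.1), p.1.2)) (by fun_prop)
  have := Finset.measurable_fun_sum _ this
  fun_prop

lemma int_inner {δ ℓ h : ℝ} (X : ℝ → ℝ≥0∞) (hX : Measurable X) :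
    ∫⁻ h' in Icc 0 δ, ∫⁻ s' in Icc (-(ℓ / 2)) (ℓ / 2),
      (Icc (h / 2) (2 * h)).indicator (fun _ => (1 : ℝ≥0∞)) h' * X s' ≤
    ENNReal.ofReal (3 * h / 2) * ∫⁻ s' in Icc (-(ℓ / 2)) (ℓ / 2), X s' := by
  simp_rw [lintegral_const_mul _ hX]
  rw [lintegral_mul_const _ (measurable_const.indicator measurableSet_Icc)]
  gcongr
  refine (setLIntegral_le_lintegral _ _).trans ?_
  rw [lintegral_indicator measurableSet_Icc, setLIntegral_const, Real.volume_Icc, one_mul]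
  apply le_of_eq; congr 1; ring

lemma int_pair {n : ℕ} (hn : 0 < n) {a c : ℝ → ℝ≥0∞} {B : ℝ≥0∞} {v : ℝ → ℝ → ℝ≥0∞}
    (hv : Measurable (fun p : ℝ × ℝ => v p.1 p.2)) (ℓ h : ℝ) :
    ∫⁻ s in Icc (-(ℓ / 2)) (ℓ / 2), ∫⁻ s' in Icc (-(ℓ / 2)) (ℓ / 2), XX n a c B v h s s' ≤
      a h * ENNReal.ofReal ℓ ^ 2 + c h * ((n + 1 : ℕ) *
        (2 * ENNReal.ofReal ℓ * ∫⁻ u in Icc (-(ℓ / 2)) (ℓ / 2), v u h) + B * ENNReal.ofReal ℓ ^ 2) := by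
  have hvh : Measurable (fun u => v u h) := hv.comp (f := fun u : ℝ => (u, h)) (by fun_prop)
  have hm1 : ∀ (s : ℝ) (i : ℕ), Measurable (fun s' => v (s + i / n * (s' - s)) h) := by
    intro s i
    exact hvh.comp (f := fun s' : ℝ => s + i / n * (s' - s)) (by fun_prop)
  have hm2 : ∀ i : ℕ, Measurable (fun p : ℝ × ℝ => v (p.1 + i / n * (p.2 - p.1)) h) := by
    intro i
    exact hvh.comp (f := fun p : ℝ × ℝ => p.1 + i / n * (p.2 - p.1)) (by fun_prop)
  have hm3 : ∀ i : ℕ, Measurable (fun s : ℝ => ∫⁻ s' in Icc (-(ℓ / 2)) (ℓ / 2),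
      v (s + i / n * (s' - s)) h) := fun i => (hm2 i).lintegral_prod_right'
  have vol : volume (Icc (-(ℓ / 2)) (ℓ / 2)) = ENNReal.ofReal ℓ := by
    rw [Real.volume_Icc]; congr 1; ring
  have e1 : ∀ s, ∫⁻ s' in Icc (-(ℓ / 2)) (ℓ / 2), XX n a c B v h s s' =
      a h * ENNReal.ofReal ℓ + c h * ((∑ i ∈ Finset.range (n + 1),
        ∫⁻ s' in Icc (-(ℓ / 2)) (ℓ / 2), v (s + i / n * (s' - s)) h) + B * ENNReal.ofReal ℓ) := by
    intro s
    unfold XX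
    have hs := Finset.measurable_fun_sum (Finset.range (n + 1)) (fun i _ => hm1 s i)
    rw [lintegral_add_left measurable_const, lintegral_const_mul (c h) (by fun_prop),
      lintegral_add_left hs, lintegral_finsetSum _ (fun i _ => hm1 s i),
      setLIntegral_const, setLIntegral_const, vol]
  simp_rw [e1]
  have hs := Finset.measurable_fun_sum (Finset.range (n + 1)) (fun i _ => hm3 i)
  rw [lintegral_add_left measurable_const, lintegral_const_mul (c h) (by fun_prop),
      lintegral_add_left hs, lintegral_finsetSum _ (fun i _ => hm3 i),
      setLIntegral_const, setLIntegral_const, vol, mul_assoc, mul_assoc, ← sq]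
  gcongr
  calc _ ≤ ∑ i ∈ Finset.range (n + 1), 2 * ENNReal.ofReal ℓ * ∫⁻ u in Icc (-(ℓ / 2)) (ℓ / 2), v u h := by
        refine Finset.sum_le_sum fun i hi => ?_
        have hn0 : (0 : ℝ) < n := by exact_mod_cast hn
        have hin : (i : ℝ) ≤ n := by exact_mod_cast Nat.lt_succ_iff.1 (Finset.mem_range.1 hi)
        exact lint_pair hvh (by positivity) ((div_le_one hn0).2 hin)
    _ = _ := by rw [Finset.sum_const, Finset.card_range, nsmul_eq_mul]

lemma assemble {n : ℕ} (hn : 0 < n) {a c : ℝ → ℝ≥0∞} {A B D E : ℝ≥0∞} {v : ℝ → ℝ → ℝ≥0∞}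
    (ha : Measurable a) (hc : Measurable c)
    (hv : Measurable (fun p : ℝ × ℝ => v p.1 p.2)) (ℓ δ : ℝ)
    (hA : ∫⁻ h in Icc 0 δ, ENNReal.ofReal (3 * h / 2) * a h ≤ A)
    (hE : ∫⁻ h in Icc 0 δ, ENNReal.ofReal (3 * h / 2) * c h ≤ E)
    (hD : ∀ s ∈ Icc (-(ℓ / 2)) (ℓ / 2),
      ∫⁻ h in Icc 0 δ, ENNReal.ofReal (3 * h / 2) * c h * v s h ≤ D) :
    ∫⁻ x in Rbox ℓ δ, ∫⁻ y in Rbox ℓ δ,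
      (Icc (x 1 / 2) (2 * x 1)).indicator (fun _ => (1 : ℝ≥0∞)) (y 1) *
        XX n a c B v (x 1) (x 0) (y 0) ≤
    ENNReal.ofReal ℓ ^ 2 * (A + (n + 1 : ℕ) * 2 * D + B * E) := by
  have hX := XX_meas (n := n) (B := B) ha hc hv
  have vol : volume (Icc (-(ℓ / 2)) (ℓ / 2)) = ENNReal.ofReal ℓ := by
    rw [Real.volume_Icc]; congr 1; ring
  have s1 : ∀ x : E2, ∫⁻ y in Rbox ℓ δ,
      (Icc (x 1 / 2) (2 * x 1)).indicator (fun _ => (1 : ℝ≥0∞)) (y 1) *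
        XX n a c B v (x 1) (x 0) (y 0) ≤ ENNReal.ofReal (3 * x 1 / 2) *
          ∫⁻ s' in Icc (-(ℓ / 2)) (ℓ / 2), XX n a c B v (x 1) (x 0) s' := by
    intro x
    have hXx : Measurable (fun s' => XX n a c B v (x 1) (x 0) s') :=
      hX.comp (f := fun s' : ℝ => ((x 0, x 1), s')) (by fun_prop)
    have hi : Measurable ((Icc (x 1 / 2) (2 * x 1)).indicator (fun _ => (1 : ℝ≥0∞))) :=
      measurable_const.indicator measurableSet_Icc
    rw [lint_E2 (fun s' h' => (Icc (x 1 / 2) (2 * x 1)).indicator (fun _ => (1 : ℝ≥0∞)) h' *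
        XX n a c B v (x 1) (x 0) s')
      ((hi.comp measurable_snd).mul (hXx.comp measurable_fst))]
    exact int_inner _ hXx
  refine (lintegral_mono s1).trans ?_
  have hm : Measurable (fun p : ℝ × ℝ => 
          ∫⁻ s' in Icc (-(ℓ / 2)) (ℓ / 2), XX n a c B v p.2 p.1 s') := hX.lintegral_prod_right'
  rw [lint_E2 (fun s h => ENNReal.ofReal (3 * h / 2) *
          ∫⁻ s' in Icc (-(ℓ / 2)) (ℓ / 2), XX n a c B v h s s') (by fun_prop)]
  have hVm : Measurable (fun h => ∫⁻ u in Icc (-(ℓ / 2)) (ℓ / 2), v u h) := by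
    have : Measurable (fun p : ℝ × ℝ => v p.2 p.1) := hv.comp measurable_swap
    exact this.lintegral_prod_right'
  set L := ENNReal.ofReal ℓ with hL
  have s2 : ∀ h, ∫⁻ s in Icc (-(ℓ / 2)) (ℓ / 2), ENNReal.ofReal (3 * h / 2) *
          ∫⁻ s' in Icc (-(ℓ / 2)) (ℓ / 2), XX n a c B v h s s' ≤
      L ^ 2 * (ENNReal.ofReal (3 * h / 2) * a h) + (((n + 1 : ℕ) * 2 * L) *
        (ENNReal.ofReal (3 * h / 2) * c h * ∫⁻ u in Icc (-(ℓ / 2)) (ℓ / 2), v u h) +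
        (B * L ^ 2) * (ENNReal.ofReal (3 * h / 2) * c h)) := by
    intro h
    have : Measurable (fun s => ∫⁻ s' in Icc (-(ℓ / 2)) (ℓ / 2), XX n a c B v h s s') :=
      hm.comp (f := fun s : ℝ => (s, h)) (by fun_prop)
    rw [lintegral_const_mul _ this]
    refine (mul_le_mul_right (int_pair hn hv ℓ h) _).trans (le_of_eq ?_)
    rw [← hL]; ring
  refine (lintegral_mono s2).trans ?_
  rw [lintegral_add_left (by fun_prop), lintegral_add_left (by fun_prop),
    lintegral_const_mul _ (by fun_prop), lintegral_const_mul _ (by fun_prop),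
    lintegral_const_mul _ (by fun_prop)]
  have hD' : ∫⁻ h in Icc 0 δ, ENNReal.ofReal (3 * h / 2) * c h *
      ∫⁻ u in Icc (-(ℓ / 2)) (ℓ / 2), v u h ≤ L * D := by
    have : ∀ h, ENNReal.ofReal (3 * h / 2) * c h * ∫⁻ u in Icc (-(ℓ / 2)) (ℓ / 2), v u h =
        ∫⁻ u in Icc (-(ℓ / 2)) (ℓ / 2), ENNReal.ofReal (3 * h / 2) * c h * v u h := by
      intro h
      rw [lintegral_const_mul]
      exact hv.comp (f := fun u : ℝ => (u, h)) (by fun_prop)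
    simp_rw [this]
    rw [lintegral_lintegral_swap (by
      apply Measurable.aemeasurable
      have : Measurable (fun p : ℝ × ℝ => v p.2 p.1) := hv.comp measurable_swap
      change Measurable (fun p : ℝ × ℝ => ENNReal.ofReal (3 * p.1 / 2) * c p.1 * v p.2 p.1)
      fun_prop)]
    refine (setLIntegral_mono measurable_const hD).trans ?_
    rw [setLIntegral_const, vol, mul_comm]
  calc _ ≤ L ^ 2 * A + ((n + 1 : ℕ) * 2 * L * (L * D) + B * L ^ 2 * E) := by gcongr
    _ = _ := by ring

lemma VV_meas {F : ℝ → ℝ → ℝ} (hF : Continuous (fun p : ℝ × ℝ => F p.1 p.2)) :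
    Measurable (fun p : ℝ × ℝ => VV F p.1 p.2) := by
  have hq : Measurable (fun p : ℝ × ℝ => qq F p.1 p.2) := by
    unfold qq
    have h1 : Measurable (fun p : ℝ × ℝ => F p.1 (2 * p.2)) :=
      hF.measurable.comp (f := fun p : ℝ × ℝ => (p.1, 2 * p.2)) (by fun_prop)
    exact (h1.sub hF.measurable).div measurable_snd
  unfold VV
  exact (hq.comp (f := fun p : ℝ × ℝ => (p.1, 2 * p.2)) (by fun_prop)).sub
    (hq.comp (f := fun p : ℝ × ℝ => (p.1, p.2 / 4)) (by fun_prop))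

lemma qq_contOn {F : ℝ → ℝ → ℝ} (hF : Continuous (fun p : ℝ × ℝ => F p.1 p.2)) (s : ℝ) :
    ContinuousOn (qq F s) (Ioi 0) := by
  unfold qq
  have h1 : Continuous (fun h : ℝ => F s (2 * h)) :=
    hF.comp (f := fun h : ℝ => (s, 2 * h)) (by fun_prop)
  have h2 : Continuous (fun h : ℝ => F s h) :=
    hF.comp (f := fun h : ℝ => (s, h)) (by fun_prop)
  exact (h1.sub h2).continuousOn.div continuousOn_id (fun x hx => ne_of_gt hx)

lemma Rbox_meas (ℓ δ : ℝ) : MeasurableSet (Rbox ℓ δ) := by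
  have h0 : Measurable fun x : E2 => x 0 := by fun_prop
  have h1 : Measurable fun x : E2 => x 1 := by fun_prop
  exact (h0 measurableSet_Icc).inter (h1 measurableSet_Icc)

lemma co_hbd {ψ : E2 → ℝ} (hψ : ConvexOn ℝ univ ψ) {ℓ δ K : ℝ} (hℓ : 0 < ℓ) (hδ : 0 < δ)
    (hK : ∀ y : E2, |y 0| ≤ ℓ / 2 → y 1 ∈ Icc 0 (2 * δ) → ∀ z ∈ subdiff ψ y, ‖z‖ ≤ K)
    (ha : co ψ (-ℓ) 0 = 0) (hb : co ψ ℓ 0 = 0) {h : ℝ} (hh : 0 ≤ h) (hh' : h ≤ δ)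
    (t : ℝ) (ht : |t| ≤ 3 * ℓ / 4) : co ψ t h ≤ K * h := by
  have seg : ∀ t, |t| ≤ ℓ → co ψ t 0 ≤ 0 := by
    intro t ht
    obtain ⟨t1, t2⟩ := abs_le.1 ht
    have := (co_convex hψ).2 (mem_univ (-ℓ, 0)) (mem_univ (ℓ, 0))
      (div_nonneg (sub_nonneg.2 t2) (by linarith : 0 ≤ 2 * ℓ))
      (div_nonneg (by linarith : 0 ≤ ℓ + t) (by linarith : 0 ≤ 2 * ℓ))
      (by field_simp; ring)
    simp only [Prod.smul_mk, Prod.mk_add_mk, smul_eq_mul, ha, hb, mul_zero, add_zero] at this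
    have e : (ℓ - t) / (2 * ℓ) * -ℓ + (ℓ + t) / (2 * ℓ) * ℓ = t := by field_simp; ring
    rwa [e] at this
  have inn : ∀ t h, |t| ≤ ℓ / 2 → 0 ≤ h → h ≤ 2 * δ → co ψ t h ≤ K * h := by
    intro t h ht h0 h1
    have := co_vert_lip hψ hℓ hδ hK t h 0 ht ⟨h0, h1⟩
    rw [sub_zero, abs_of_nonneg h0] at this
    linarith [seg t (by linarith)]
  obtain ⟨t1, t2⟩ := abs_le.1 ht
  rcases le_or_gt |t| (ℓ / 2) with hc | hc
  · exact inn t h hc hh (by linarith)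
  rcases lt_abs.1 hc with h1 | h1
  · have := cvx_mid (co_convex hψ) ℓ (2 * t - ℓ) 0 (2 * h)
    have e1 : (ℓ + (2 * t - ℓ)) / 2 = t := by ring
    have e2 : (0 + 2 * h) / 2 = h := by ring
    rw [e1, e2, hb] at this
    have := inn (2 * t - ℓ) (2 * h) (abs_le.2 ⟨by linarith, by linarith⟩) (by linarith) (by linarith)
    linarith
  · have := cvx_mid (co_convex hψ) (-ℓ) (2 * t + ℓ) 0 (2 * h)
    have e1 : (-ℓ + (2 * t + ℓ)) / 2 = t := by ring
    have e2 : (0 + 2 * h) / 2 = h := by ring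
    rw [e1, e2, ha] at this
    have := inn (2 * t + ℓ) (2 * h) (abs_le.2 ⟨by linarith, by linarith⟩) (by linarith) (by linarith)
    linarith

def om (γ h : ℝ) : ℝ≥0∞ := ENNReal.ofReal (((h + γ) ^ 2)⁻¹)

def aa (γ δ K : ℝ) : ℝ → ℝ≥0∞ :=
  (Icc γ (δ / 2))ᶜ.indicator (fun h => om γ h * ENNReal.ofReal (2 * K))

def cc (γ δ : ℝ) : ℝ → ℝ≥0∞ := (Icc γ (δ / 2)).indicator (fun h => om γ h)

lemma om_meas (γ : ℝ) : Measurable (om γ) := by unfold om; fun_prop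

lemma rho_le {γ h : ℝ} (hγ : 0 < γ) (hh : 0 ≤ h) :
    3 * h / 2 * ((h + γ) ^ 2)⁻¹ ≤ 3 / 2 * (1 / (h + γ)) := by
  have : 0 < h + γ := by linarith
  rw [← div_eq_mul_inv, div_le_iff₀ (by positivity)]
  have : 3 / 2 * (1 / (h + γ)) * (h + γ) ^ 2 = 3 / 2 * (h + γ) := by field_simp
  rw [this]; linarith

lemma aa_int {γ δ K : ℝ} (hγ : 0 < γ) (hδ : 0 < δ) (hK : 0 < K) :
    ∫⁻ h in Icc 0 δ, ENNReal.ofReal (3 * h / 2) * aa γ δ K h ≤ ENNReal.ofReal (6 * K) := by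
  have key : ∀ h ∈ Icc 0 δ, ENNReal.ofReal (3 * h / 2) * aa γ δ K h ≤
      (Icc 0 γ).indicator (fun _ => ENNReal.ofReal (3 * K / γ)) h +
      (Icc (δ / 2) δ).indicator (fun _ => ENNReal.ofReal (6 * K / δ)) h := by
    intro h hh
    unfold aa
    by_cases hg : h ∈ Icc γ (δ / 2)
    · rw [indicator_of_notMem (by simpa using hg)]; simp
    rw [indicator_of_mem (by simpa using hg)]
    unfold om
    rw [← mul_assoc, ← ENNReal.ofReal_mul (by linarith [hh.1]), ← ENNReal.ofReal_mul (by
      have := hh.1; positivity)]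
    have hr := rho_le hγ hh.1
    have h0 := hh.1
    by_cases h1 : h ≤ γ
    · refine le_trans ?_ (le_add_of_nonneg_right zero_le)
      rw [indicator_of_mem (by exact ⟨hh.1, h1⟩)]
      apply ENNReal.ofReal_le_ofReal
      have : 1 / (h + γ) ≤ 1 / γ := one_div_le_one_div_of_le hγ (by linarith)
      have e : 3 * K / γ = 3 / 2 * (1 / γ) * (2 * K) := by field_simp
      rw [e]
      exact mul_le_mul_of_nonneg_right (hr.trans (mul_le_mul_of_nonneg_left this (by norm_num))) (by linarith)
    · have h2 : δ / 2 < h := by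
        by_contra hcon
        exact hg ⟨by linarith, by linarith⟩
      refine le_trans ?_ (le_add_of_nonneg_left zero_le)
      rw [indicator_of_mem (by exact ⟨h2.le, hh.2⟩)]
      apply ENNReal.ofReal_le_ofReal
      have : 1 / (h + γ) ≤ 1 / (δ / 2) := one_div_le_one_div_of_le (by linarith) (by linarith)
      have e : 6 * K / δ = 3 / 2 * (1 / (δ / 2)) * (2 * K) := by field_simp; ring
      rw [e]
      exact mul_le_mul_of_nonneg_right (hr.trans (mul_le_mul_of_nonneg_left this (by norm_num))) (by linarith)
  refine (setLIntegral_mono' measurableSet_Icc key).trans ((setLIntegral_le_lintegral _ _).trans ?_)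
  rw [lintegral_add_left (measurable_const.indicator measurableSet_Icc),
    lintegral_indicator measurableSet_Icc, lintegral_indicator measurableSet_Icc,
    setLIntegral_const, setLIntegral_const, Real.volume_Icc, Real.volume_Icc,
    ← ENNReal.ofReal_mul (by positivity), ← ENNReal.ofReal_mul (by positivity),
    ← ENNReal.ofReal_add (by rw [sub_zero]; positivity) (by
      apply mul_nonneg (by positivity); linarith)]
  apply ENNReal.ofReal_le_ofReal
  apply le_of_eq; field_simp; ring

lemma cc_le {γ δ : ℝ} (hγ : 0 < γ) (h : ℝ) (hh : 0 ≤ h) :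
    ENNReal.ofReal (3 * h / 2) * cc γ δ h ≤
      (Icc γ (δ / 2)).indicator (fun h => ENNReal.ofReal (3 / 2) * ENNReal.ofReal (1 / h)) h := by
  unfold cc
  by_cases hg : h ∈ Icc γ (δ / 2)
  · have h0 : 0 < h := lt_of_lt_of_le hγ hg.1
    rw [indicator_of_mem hg, indicator_of_mem hg]
    unfold om
    rw [← ENNReal.ofReal_mul (by positivity), ← ENNReal.ofReal_mul (by positivity)]
    apply ENNReal.ofReal_le_ofReal
    refine (rho_le hγ hh).trans ?_
    have : 1 / (h + γ) ≤ 1 / h := one_div_le_one_div_of_le h0 (by linarith)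
    gcongr
  · rw [indicator_of_notMem hg, indicator_of_notMem hg]; simp

lemma cc_int {γ δ : ℝ} (hγ : 0 < γ) (hδ : 0 < δ) :
    ∫⁻ h in Icc 0 δ, ENNReal.ofReal (3 * h / 2) * cc γ δ h ≤
      ENNReal.ofReal (3 / 2 * Real.log (1 + δ / γ)) := by
  refine (setLIntegral_mono' measurableSet_Icc fun h hh => cc_le hγ h hh.1).trans
    ((setLIntegral_le_lintegral _ _).trans ?_)
  rw [lintegral_indicator measurableSet_Icc, lintegral_const_mul _ (by fun_prop),
    ENNReal.ofReal_mul (by norm_num)]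
  gcongr
  exact lint_log hγ hδ

lemma cv_int {F : ℝ → ℝ → ℝ} (hF : ConvexOn ℝ univ (fun p : ℝ × ℝ => F p.1 p.2))
    {γ δ K s : ℝ} (hγ : 0 < γ) (hq : ∀ u, 0 < u → u ≤ δ → |qq F s u| ≤ K) :
    ∫⁻ h in Icc 0 δ, ENNReal.ofReal (3 * h / 2) * cc γ δ h * ENNReal.ofReal (VV F s h) ≤
      ENNReal.ofReal (21 * K) := by
  have key : ∀ h ∈ Icc 0 δ,
      ENNReal.ofReal (3 * h / 2) * cc γ δ h * ENNReal.ofReal (VV F s h) ≤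
      (Icc γ (δ / 2)).indicator (fun h => ENNReal.ofReal (3 / 2) *
        ENNReal.ofReal ((qq F s (2 * h) - qq F s (h / 4)) / h)) h := by
    intro h hh
    refine (mul_le_mul_left (cc_le hγ h hh.1) _).trans ?_
    by_cases hg : h ∈ Icc γ (δ / 2)
    · have h0 : 0 < h := lt_of_lt_of_le hγ hg.1
      rw [indicator_of_mem hg, indicator_of_mem hg, mul_assoc, ← ENNReal.ofReal_mul (by positivity)]
      apply le_of_eq
      congr 2
      unfold VV; ring
    · rw [indicator_of_notMem hg, indicator_of_notMem hg]; simp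
  have hc : Continuous (fun p : ℝ × ℝ => F p.1 p.2) := hF.locallyLipschitz.continuous
  have hm : Measurable (fun h => (qq F s (2 * h) - qq F s (h / 4)) / h) :=
    ((VV_meas hc).comp (f := fun h : ℝ => (s, h)) (by fun_prop)).div measurable_id
  refine (setLIntegral_mono' measurableSet_Icc key).trans ((setLIntegral_le_lintegral _ _).trans ?_)
  rw [lintegral_indicator measurableSet_Icc, lintegral_const_mul _ (by fun_prop)]
  have := lint_V (q := qq F s) hγ (qq_contOn hc s) hq (fun h hh => VV_nonneg hF s hh)
  refine (mul_le_mul_right this _).trans (le_of_eq ?_)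
  rw [← ENNReal.ofReal_mul (by norm_num)]
  congr 1; ring

/-- upper bound on the weighted double integral of `|T⊥(y) − T⊥(x)|`. -/
theorem stmt14 : ∃ C : ℝ, 0 < C ∧
    ∀ ℓ δ : ℝ, 0 < ℓ → 0 < δ →
    ∀ ψ : E2 → ℝ, ConvexOn ℝ Set.univ ψ →
    ∀ a b : E2, a 0 = -ℓ → a 1 = 0 → b 0 = ℓ → b 1 = 0 → ψ a = 0 → ψ b = 0 →
    ∀ x₀ ∈ segment ℝ a b, (0 : E2) ∈ subdiff ψ x₀ →
    ∀ K : ℝ, 0 < K →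
    (∀ y : E2, |y 0| ≤ ℓ / 2 → y 1 ∈ Icc 0 (2 * δ) → ∀ z ∈ subdiff ψ y, ‖z‖ ≤ K) →
    ∀ ε : ℝ, ε = - sInf ((fun t : ℝ => ψ ((1 - t) • a + t • b)) '' Icc 0 1) →
    ∀ γ : ℝ, 0 < γ → ε / K ≤ γ →
    ∫⁻ x in Rbox ℓ δ, ∫⁻ y in Rbox ℓ δ,
        ENNReal.ofReal (|gradient ψ y 1 - gradient ψ x 1| * phiWeight γ x y) ≤
      ENNReal.ofReal (C * K * ℓ ^ 2 * (Real.sqrt (Real.log (1 + δ / γ)) + 1)) := by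
  refine ⟨200, by norm_num, ?_⟩
  intro ℓ δ hℓ hδ ψ hψ a b ha0 ha1 hb0 hb1 hψa hψb x₀ hx₀ hsub K hK0 hK ε hε γ hγ hεγ
  have hF := co_convex hψ
  have hca : co ψ (-ℓ) 0 = 0 := by
    have := co_eta a; rw [ha0, ha1] at this; unfold co; rw [this, hψa]
  have hcb : co ψ ℓ 0 = 0 := by
    have := co_eta b; rw [hb0, hb1] at this; unfold co; rw [this, hψb]
  have hmin : ∀ y, ψ x₀ ≤ ψ y := fun y => by simpa using hsub y
  have hlow : ∀ y, -ε ≤ ψ y := by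
    intro y
    refine le_trans ?_ (hmin y)
    rw [hε, neg_neg]
    apply csInf_le
    · refine ⟨ψ x₀, ?_⟩
      rintro _ ⟨t, _, rfl⟩
      exact hmin _
    · rw [segment_eq_image] at hx₀
      obtain ⟨t, ht, rfl⟩ := hx₀
      exact ⟨t, ht, rfl⟩
  have hεK : ε ≤ K * γ := by rw [div_le_iff₀ hK0] at hεγ; linarith
  set lg := Real.log (1 + δ / γ) with hlg
  have hlg0 : 0 ≤ lg := Real.log_nonneg (by have : 0 < δ / γ := by positivity
                                            linarith)
  set n : ℕ := ⌈Real.sqrt lg⌉₊ + 2 with hn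
  have hn2 : 2 ≤ n := by omega
  have hn1 : Real.sqrt lg ≤ n := by
    rw [hn]; push_cast; linarith [Nat.le_ceil (Real.sqrt lg)]
  have hn3 : (n : ℝ) + 1 ≤ Real.sqrt lg + 4 := by
    rw [hn]; push_cast; linarith [Nat.ceil_lt_add_one (Real.sqrt_nonneg lg)]
  have hnpos : (0 : ℝ) < n := by exact_mod_cast (by omega : 0 < n)
  set v : ℝ → ℝ → ℝ≥0∞ := fun s h => ENNReal.ofReal (VV (co ψ) s h) with hv
  have hvm : Measurable (fun p : ℝ × ℝ => v p.1 p.2) := (VV_meas (co_cont hψ)).ennreal_ofReal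
  have ham : Measurable (aa γ δ K) :=
    ((om_meas γ).mul_const _).indicator measurableSet_Icc.compl
  have hcm : Measurable (cc γ δ) := (om_meas γ).indicator measurableSet_Icc
  have hmem : ∀ᵐ x ∂(volume.restrict (Rbox ℓ δ)), x ∈ Rbox ℓ δ ∧ DifferentiableAt ℝ ψ x := by
    filter_upwards [ae_restrict_mem (Rbox_meas ℓ δ), ae_restrict_of_ae (ae_diff hψ)] with x h1 h2
    exact ⟨h1, h2⟩
  have major : ∫⁻ x in Rbox ℓ δ, ∫⁻ y in Rbox ℓ δ,
        ENNReal.ofReal (|gradient ψ y 1 - gradient ψ x 1| * phiWeight γ x y) ≤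
      ∫⁻ x in Rbox ℓ δ, ∫⁻ y in Rbox ℓ δ,
      (Icc (x 1 / 2) (2 * x 1)).indicator (fun _ => (1 : ℝ≥0∞)) (y 1) *
        XX n (aa γ δ K) (cc γ δ) (ENNReal.ofReal (16 * K / n)) v (x 1) (x 0) (y 0) := by
    apply lintegral_mono_ae
    filter_upwards [hmem] with x hx
    apply lintegral_mono_ae
    filter_upwards [hmem] with y hy
    obtain ⟨⟨hx0, hx1⟩, hxd⟩ := hx
    obtain ⟨⟨hy0, hy1⟩, hyd⟩ := hy
    have ax : |x 0| ≤ ℓ / 2 := abs_le.2 ⟨hx0.1, hx0.2⟩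
    have ay : |y 0| ≤ ℓ / 2 := abs_le.2 ⟨hy0.1, hy0.2⟩
    unfold phiWeight
    by_cases hphi : x 1 / 2 ≤ y 1 ∧ y 1 ≤ 2 * x 1
    swap
    · rw [if_neg hphi]; simp
    rw [if_pos hphi, indicator_of_mem (show y 1 ∈ Icc (x 1 / 2) (2 * x 1) from hphi), one_mul,
      mul_comm, ENNReal.ofReal_mul (by positivity)]
    unfold XX
    by_cases hg : x 1 ∈ Icc γ (δ / 2)
    · refine le_trans ?_ (le_add_of_nonneg_left zero_le)
      unfold cc
      rw [indicator_of_mem hg]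
      refine mul_le_mul_right ?_ _
      have h0 : 0 < x 1 := lt_of_lt_of_le hγ hg.1
      have pb := pointwise_bound hF hn2 (ℓ := ℓ) (K := K) h0 (by
        intro t ht
        refine ⟨?_, co_hbd hψ hℓ hδ hK hca hcb h0.le hx1.2 t ht⟩
        have h1 : K * γ ≤ K * x 1 := mul_le_mul_of_nonneg_left hg.1 hK0.le
        have h2 : -ε ≤ co ψ t (x 1) := hlow _
        linarith) ax ay hphi.1 hphi.2 (grad_vert hψ hxd) (grad_vert hψ hyd)
      refine (ENNReal.ofReal_le_ofReal pb).trans ?_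
      rw [ENNReal.ofReal_add (Finset.sum_nonneg fun i _ => VV_nonneg hF _ h0) (by positivity),
        ENNReal.ofReal_sum_of_nonneg (fun i _ => VV_nonneg hF _ h0)]
    · refine le_trans ?_ (le_add_of_nonneg_right zero_le)
      unfold aa
      rw [indicator_of_mem (by simpa using hg)]
      refine mul_le_mul_right (ENNReal.ofReal_le_ofReal ?_) _
      have g1 := grad_abs hψ hK hxd ax ⟨hx1.1, by linarith [hx1.2]⟩
      have g2 := grad_abs hψ hK hyd ay ⟨hy1.1, by linarith [hy1.2]⟩
      refine (abs_sub _ _).trans ?_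
      linarith
  refine major.trans ?_
  have asm := assemble (n := n) (by omega) (B := ENNReal.ofReal (16 * K / n)) ham hcm hvm ℓ δ
    (aa_int hγ hδ hK0) (cc_int hγ hδ) (D := ENNReal.ofReal (21 * K)) (by
      intro s hs
      have as : |s| ≤ ℓ / 2 := abs_le.2 ⟨hs.1, hs.2⟩
      refine cv_int hF hγ ?_
      intro u hu0 hu
      have l1 := co_vert_lip hψ hℓ hδ hK s (2 * u) u as ⟨by linarith, by linarith⟩
      have l2 := co_vert_lip hψ hℓ hδ hK s u (2 * u) as ⟨by linarith, by linarith⟩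
      have e1 : |2 * u - u| = u := by rw [abs_of_nonneg] <;> linarith
      have e2 : |u - 2 * u| = u := by rw [abs_sub_comm, e1]
      rw [e1] at l1
      rw [e2] at l2
      unfold qq
      rw [abs_div, abs_of_pos hu0, div_le_iff₀ hu0, abs_le]
      constructor <;> linarith)
  refine asm.trans ?_
  rw [← ENNReal.ofReal_pow hℓ.le, ← ENNReal.ofReal_natCast, ← ENNReal.ofReal_ofNat 2,
    ← ENNReal.ofReal_mul (by positivity), ← ENNReal.ofReal_mul (by positivity),
    ← ENNReal.ofReal_mul (by positivity), ← ENNReal.ofReal_add (by positivity) (by positivity),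
    ← ENNReal.ofReal_add (by positivity) (by positivity), ← ENNReal.ofReal_mul (by positivity)]
  apply ENNReal.ofReal_le_ofReal
  have hsq : Real.sqrt lg * Real.sqrt lg = lg := Real.mul_self_sqrt hlg0
  have hs0 := Real.sqrt_nonneg lg
  have t1 : 16 * K / n * (3 / 2 * lg) ≤ 24 * K * Real.sqrt lg := by
    rw [div_mul_eq_mul_div, div_le_iff₀ hnpos]
    have : lg ≤ Real.sqrt lg * n := by nlinarith
    nlinarith [mul_le_mul_of_nonneg_left this hK0.le]
  have t2 : ((n + 1 : ℕ) : ℝ) * 2 * (21 * K) ≤ (Real.sqrt lg + 4) * 2 * (21 * K) := by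
    push_cast; gcongr
  have : 6 * K + ((n + 1 : ℕ) : ℝ) * 2 * (21 * K) + 16 * K / n * (3 / 2 * lg) ≤
      200 * K * (Real.sqrt lg + 1) := by
    nlinarith [mul_nonneg hK0.le hs0]
  calc _ ≤ ℓ ^ 2 * (200 * K * (Real.sqrt lg + 1)) := by gcongr
    _ = _ := by ring
end
end
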